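/- Let A, g be positive integers, i an integer with gcd(i, g) = 1, and α a real number. Suppose there exist integers a and q ≥ 1 with gcd(a, q) = 1 and |α − a/q| ≤ 1/q². Then there is a constant C (depending only on A and g) such that for all x ≥ 2, |∑_{p ≤ x, p ≡ i (mod g)} (log p)·e(αAp)| ≤ C·(x^{4/5} + x·q^{−1/2} + x^{1/2}·q^{1/2})·(log x)³, where the sum is over primes p ≤ x with p ≡ i (mod g) and e(θ) = e^{2πiθ}. -/

import Mathlib

attribute [local instance] Classical.propDecidable

/-- `e θ = e^{2πiθ}`. -/
noncomputable def e (θ : ℝ) : ℂ := Complex.exp (2 * Real.pi * Complex.I * θ)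


/-- Distance from a real number to the nearest integer. -/
noncomputable def nearestIntDist (θ : ℝ) : ℝ := |θ - round θ|

lemma nearestIntDist_nonneg (θ : ℝ) : 0 ≤ nearestIntDist θ := abs_nonneg _

lemma nearestIntDist_le_abs_sub (θ : ℝ) (m : ℤ) : nearestIntDist θ ≤ |θ - m| := round_le θ m

lemma nearestIntDist_neg (θ : ℝ) : nearestIntDist (-θ) = nearestIntDist θ := by
  apply le_antisymm
  · have h := nearestIntDist_le_abs_sub (-θ) (-round θ)
    rwa [show -θ - ((-round θ : ℤ) : ℝ) = -(θ - round θ) by push_cast; ring, abs_neg] at h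
  · have h := nearestIntDist_le_abs_sub θ (-round (-θ))
    rwa [show θ - ((-round (-θ) : ℤ) : ℝ) = -(-θ - round (-θ)) by push_cast; ring, abs_neg] at h

/-- The truncated kernel `min (B, 1 / ‖θ‖)`, equal to `B` when `θ` is an integer. -/
noncomputable def truncKernel (B θ : ℝ) : ℝ :=
  if B * nearestIntDist θ ≤ 1 then B else 1 / nearestIntDist θ

lemma truncKernel_neg (B θ : ℝ) : truncKernel B (-θ) = truncKernel B θ := by
  simp only [truncKernel, nearestIntDist_neg]

lemma truncKernel_le {B : ℝ} (θ : ℝ) : truncKernel B θ ≤ B := by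
  unfold truncKernel
  split_ifs with h
  · exact le_rfl
  · have h0 := nearestIntDist_nonneg θ
    rcases h0.eq_or_lt with h1 | h1
    · rw [← h1] at h; norm_num at h
    · rw [div_le_iff₀ h1]; linarith

lemma truncKernel_mul_le (B θ : ℝ) : truncKernel B θ * nearestIntDist θ ≤ 1 := by
  unfold truncKernel
  split_ifs with h
  · exact h
  · rw [one_div]; exact inv_mul_le_one

lemma truncKernel_nonneg {B : ℝ} (hB : 0 ≤ B) (θ : ℝ) : 0 ≤ truncKernel B θ := by
  have h0 := nearestIntDist_nonneg θ
  unfold truncKernel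
  split_ifs with h
  · exact hB
  · positivity

lemma le_truncKernel {B θ s : ℝ} (h1 : s ≤ B) (h2 : s * nearestIntDist θ ≤ 1) :
    s ≤ truncKernel B θ := by
  unfold truncKernel
  split_ifs with h
  · exact h1
  · have h0 := nearestIntDist_nonneg θ
    rcases h0.eq_or_lt with h3 | h3
    · rw [← h3] at h; norm_num at h
    · rwa [le_div_iff₀ h3]

lemma norm_e (θ : ℝ) : ‖e θ‖ = 1 := by
  rw [e, show (2 * Real.pi * Complex.I * θ : ℂ) = ((2 * Real.pi * θ : ℝ) : ℂ) * Complex.I by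
    push_cast; ring]
  exact Complex.norm_exp_ofReal_mul_I _

lemma e_add (s t : ℝ) : e (s + t) = e s * e t := by
  rw [e, e, e, ← Complex.exp_add]; push_cast; ring_nf

lemma e_neg (t : ℝ) : e (-t) = (starRingEnd ℂ) (e t) := by
  rw [e, e, ← Complex.exp_conj]
  congr 1
  simp [Complex.conj_ofNat]

lemma e_mul_natCast (θ : ℝ) (n : ℕ) : e (θ * n) = e θ ^ n := by
  rw [e, e, ← Complex.exp_nat_mul]; push_cast; ring_nf

lemma e_intCast (m : ℤ) : e m = 1 := by
  rw [e, Complex.exp_eq_one_iff]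
  exact ⟨m, by push_cast; ring⟩

lemma two_mul_nearestIntDist_le (θ : ℝ) : 2 * nearestIntDist θ ≤ ‖e θ - 1‖ := by
  set t := θ - round θ with ht
  have h1 : e θ = e t := by
    have := e_add t (round θ)
    rwa [e_intCast, mul_one, ht, sub_add_cancel] at this
  have h2 : ‖e t - 1‖ = ‖2 * Real.sin (Real.pi * t)‖ := by
    have := Complex.norm_exp_I_mul_ofReal_sub_one (2 * Real.pi * t)
    rw [show 2 * Real.pi * t / 2 = Real.pi * t by ring] at this
    rw [← this, e]; push_cast; ring_nf
  have h3 : |t| ≤ 1 / 2 := abs_sub_round θ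
  have hpi := Real.pi_pos
  have h4 := Real.mul_le_sin (x := Real.pi * |t|) (by positivity) (by nlinarith)
  have h5 : |Real.sin (Real.pi * t)| = |Real.sin (Real.pi * |t|)| := by
    rcases abs_choice t with h | h <;> rw [h]
    rw [mul_neg, Real.sin_neg, abs_neg]
  rw [h1, h2, norm_mul, Real.norm_eq_abs (Real.sin _), h5]
  have h6 : 2 / Real.pi * (Real.pi * |t|) = 2 * |t| := by field_simp
  rw [h6] at h4
  have h7 := le_abs_self (Real.sin (Real.pi * |t|))
  have h8 := abs_nonneg t
  have h9 : nearestIntDist θ = |t| := rfl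
  rw [h9]
  norm_num
  linarith

lemma norm_sum_Ico_e_le {B : ℝ} (θ : ℝ) {a b : ℕ} (hB : ((b - a : ℕ) : ℝ) ≤ B) :
    ‖∑ n ∈ Finset.Ico a b, e (θ * n)‖ ≤ truncKernel B θ := by
  apply le_truncKernel
  · refine (norm_sum_le _ _).trans ?_
    simpa [norm_e] using hB
  · rcases le_total a b with hab | hab
    · have h := geom_sum_Ico_mul (e θ) hab
      have h2 : ‖∑ n ∈ Finset.Ico a b, e (θ * n)‖ * ‖e θ - 1‖ ≤ 2 := by
        simp only [e_mul_natCast]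
        rw [← norm_mul, h]
        refine (norm_sub_le _ _).trans ?_
        simp only [norm_pow, norm_e, one_pow]; norm_num
      have h3 := two_mul_nearestIntDist_le θ
      nlinarith [norm_nonneg (∑ n ∈ Finset.Ico a b, e (θ * n))]
    · simp [Finset.Ico_eq_empty_of_le hab]

/-- Abel summation with the increasing weight `log`. -/
lemma norm_sum_log_mul_e_le (θ : ℝ) (Y : ℕ) :
    ‖∑ m ∈ Finset.Ioc 0 Y, (Real.log m : ℂ) * e (θ * m)‖ ≤ Real.log Y * truncKernel Y θ := by
  rcases Nat.eq_zero_or_pos Y with rfl | hY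
  · simp
  have hlog : ∀ m : ℕ, 1 ≤ m → (Real.log m : ℝ) =
      ∑ k ∈ Finset.Ico 1 m, (Real.log (k + 1 : ℕ) - Real.log k) := by
    intro m hm
    rw [Finset.sum_Ico_sub (fun k : ℕ => Real.log k) hm]
    simp
  have h1 : ∑ m ∈ Finset.Ioc 0 Y, (Real.log m : ℂ) * e (θ * m) =
      ∑ k ∈ Finset.Ico 1 Y, ((Real.log (k + 1 : ℕ) - Real.log k : ℝ) : ℂ) *
        ∑ m ∈ Finset.Ico (k + 1) (Y + 1), e (θ * m) := by
    simp_rw [Finset.mul_sum]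
    rw [Finset.sum_sigma']
    have : ∀ m ∈ Finset.Ioc 0 Y, (Real.log m : ℂ) * e (θ * m) =
        ∑ k ∈ Finset.Ico 1 m, ((Real.log (k + 1 : ℕ) - Real.log k : ℝ) : ℂ) * e (θ * m) := by
      intro m hm
      rw [← Finset.sum_mul, ← Complex.ofReal_sum, ← hlog m (by simp at hm; omega)]
    rw [Finset.sum_congr rfl this, Finset.sum_sigma']
    refine Finset.sum_bij' (fun p _ => ⟨p.2, p.1⟩) (fun p _ => ⟨p.2, p.1⟩) ?_ ?_ ?_ ?_ ?_ <;>
      simp <;> intros <;> omega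
  rw [h1, hlog Y hY, Finset.sum_mul]
  refine (norm_sum_le _ _).trans (Finset.sum_le_sum fun k hk => ?_)
  have hk1 : (1 : ℝ) ≤ k := by simp at hk; exact_mod_cast hk.1
  have hpos : 0 ≤ Real.log (k + 1 : ℕ) - Real.log k := by
    rw [sub_nonneg]; apply Real.log_le_log (by linarith); push_cast; linarith
  rw [norm_mul, Complex.norm_real, Real.norm_of_nonneg hpos]
  refine mul_le_mul_of_nonneg_left (norm_sum_Ico_e_le θ ?_) hpos
  exact_mod_cast (by omega : Y + 1 - (k + 1) ≤ Y)

lemma sum_range_inv_le (N : ℕ) : ∑ j ∈ Finset.range N, ((j : ℝ))⁻¹ ≤ 1 + Real.log N := by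
  cases N with
  | zero => simp
  | succ n =>
    rw [Finset.sum_range_succ']
    have h := harmonic_le_one_add_log n
    have h2 : ((harmonic n : ℚ) : ℝ) = ∑ j ∈ Finset.range n, ((j + 1 : ℕ) : ℝ)⁻¹ := by
      simp [harmonic]
    rw [h2] at h
    have h3 : Real.log n ≤ Real.log (n + 1 : ℕ) := by
      rcases Nat.eq_zero_or_pos n with rfl | hn
      · simp
      · apply Real.log_le_log
        · exact_mod_cast hn
        · push_cast; linarith
    simp only [Nat.cast_zero, inv_zero, add_zero]
    linarith

/-- A kernel bounded by `B` and by `1 / ‖β h‖`, summed over a block of `Q` consecutive integers,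
when the points `β h` of the block are `1 / N`-separated modulo one. -/
lemma sum_block_le {β B : ℝ} {Q N h₀ : ℕ} (hN : 1 ≤ N) (hB : 0 ≤ B) (φ : ℕ → ℝ)
    (hφ0 : ∀ h ∈ Finset.Ico h₀ (h₀ + Q), 0 ≤ φ h)
    (hφB : ∀ h ∈ Finset.Ico h₀ (h₀ + Q), φ h ≤ B)
    (hφ : ∀ h ∈ Finset.Ico h₀ (h₀ + Q), φ h * nearestIntDist (β * h) ≤ 1)
    (hsp : ∀ h : ℕ, 1 ≤ h → h < Q → 1 / (N : ℝ) ≤ nearestIntDist (β * h)) :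
    ∑ h ∈ Finset.Ico h₀ (h₀ + Q), φ h ≤ 2 * B + 2 * N * (1 + Real.log N) := by
  have hN0 : (0 : ℝ) < N := by exact_mod_cast hN
  set cell : ℕ → ℕ := fun h => ⌊N * Int.fract (β * h)⌋₊ with hcell
  set ψ : ℕ → ℝ := fun j => (if j = 0 then B else 0) + (if j = N - 1 then B else 0)
    + N * (j : ℝ)⁻¹ + N * (((N - 1 - j : ℕ) : ℝ))⁻¹ with hψ
  have hnn : ∀ h : ℕ, 0 ≤ N * Int.fract (β * h) := fun h =>
    mul_nonneg hN0.le (Int.fract_nonneg _)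
  have hcl : ∀ h : ℕ, (cell h : ℝ) ≤ N * Int.fract (β * h) := fun h => Nat.floor_le (hnn h)
  have hcu : ∀ h : ℕ, N * Int.fract (β * h) < cell h + 1 := fun h => Nat.lt_floor_add_one _
  have hcN : ∀ h, cell h < N := by
    intro h
    have h1 := hcl h
    have h2 := Int.fract_lt_one (β * h)
    have h3 : (cell h : ℝ) < N := by nlinarith
    exact_mod_cast h3
  have hlt : ∀ a b : ℕ, a < b → b - a < Q → cell a ≠ cell b := by
    intro a b hab hQ heq
    have h1 := hsp (b - a) (by omega) hQ
    have h2 := nearestIntDist_le_abs_sub (β * (b - a : ℕ)) (⌊β * b⌋ - ⌊β * a⌋)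
    have h3 : β * (b - a : ℕ) - ((⌊β * b⌋ - ⌊β * a⌋ : ℤ) : ℝ) =
        Int.fract (β * b) - Int.fract (β * a) := by
      rw [Nat.cast_sub hab.le]; push_cast
      rw [← Int.self_sub_floor, ← Int.self_sub_floor]; ring
    rw [h3] at h2
    have h4 : |Int.fract (β * b) - Int.fract (β * a)| < 1 / N := by
      rw [lt_div_iff₀ hN0]
      have e1 := hcl a
      have e2 := hcu a
      have e3 := hcl b
      have e4 := hcu b
      rw [heq] at e1 e2
      rw [show ∀ t : ℝ, |t| * N = |t * N| from fun t => by rw [abs_mul, abs_of_pos hN0], abs_lt]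
      constructor <;> nlinarith
    linarith
  have hinj : Set.InjOn cell (Finset.Ico h₀ (h₀ + Q)) := by
    intro a ha b hb heq
    simp only [Finset.coe_Ico, Set.mem_Ico] at ha hb
    rcases lt_trichotomy a b with h | h | h
    · exact absurd heq (hlt a b h (by omega))
    · exact h
    · exact absurd heq.symm (hlt b a h (by omega))
  have hψ0 : ∀ j, 0 ≤ ψ j := by
    intro j
    have h1 : 0 ≤ if j = 0 then B else 0 := by split_ifs <;> simp [hB]
    have h2 : 0 ≤ if j = N - 1 then B else 0 := by split_ifs <;> simp [hB]
    simp only [hψ]; positivity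
  have hpt : ∀ h ∈ Finset.Ico h₀ (h₀ + Q), φ h ≤ ψ (cell h) := by
    intro h hh
    have p0 := hφ0 h hh
    have p1 := hφB h hh
    have p2 := hφ h hh
    have h1 : 0 ≤ if cell h = 0 then B else 0 := by split_ifs <;> simp [hB]
    have h2 : 0 ≤ if cell h = N - 1 then B else 0 := by split_ifs <;> simp [hB]
    have h3 : 0 ≤ N * (cell h : ℝ)⁻¹ := by positivity
    have h4 : 0 ≤ N * (((N - 1 - cell h : ℕ) : ℝ))⁻¹ := by positivity
    have e1 := hcl h
    have e2 := hcu h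
    have hle : ∀ j : ℕ, 0 < j → (j : ℝ) ≤ N * nearestIntDist (β * h) → φ h ≤ N * (j : ℝ)⁻¹ := by
      intro j hj hjn
      have hj' : (0 : ℝ) < j := by exact_mod_cast hj
      rw [← div_eq_mul_inv, le_div_iff₀ hj']
      nlinarith
    simp only [hψ]
    have hmin : nearestIntDist (β * h) = min (Int.fract (β * h)) (1 - Int.fract (β * h)) :=
      abs_sub_round_eq_min _
    rcases min_choice (Int.fract (β * h)) (1 - Int.fract (β * h)) with hm | hm
    · rw [hm] at hmin
      rcases Nat.eq_zero_or_pos (cell h) with hz | hz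
      · rw [if_pos hz] at h1 ⊢; linarith
      · have := hle _ hz (by rw [hmin]; exact e1)
        linarith
    · rw [hm] at hmin
      rcases Nat.eq_zero_or_pos (N - 1 - cell h) with hz | hz
      · have := hcN h
        rw [if_pos (show cell h = N - 1 by omega)] at h2 ⊢; linarith
      · have := hle _ hz (by
          rw [hmin, Nat.cast_sub (by omega), Nat.cast_sub hN]; push_cast; linarith)
        linarith
  calc ∑ h ∈ Finset.Ico h₀ (h₀ + Q), φ h ≤ ∑ h ∈ Finset.Ico h₀ (h₀ + Q), ψ (cell h) :=
        Finset.sum_le_sum hpt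
    _ = ∑ j ∈ (Finset.Ico h₀ (h₀ + Q)).image cell, ψ j := (Finset.sum_image hinj).symm
    _ ≤ ∑ j ∈ Finset.range N, ψ j := by
        apply Finset.sum_le_sum_of_subset_of_nonneg
        · intro j hj
          obtain ⟨h, -, rfl⟩ := Finset.mem_image.mp hj
          exact Finset.mem_range.mpr (hcN h)
        · intro j _ _; exact hψ0 j
    _ ≤ 2 * B + 2 * N * (1 + Real.log N) := by
        simp only [hψ, Finset.sum_add_distrib, ← Finset.mul_sum]
        rw [Finset.sum_range_reflect (fun j : ℕ => ((j : ℝ))⁻¹) N]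
        rw [Finset.sum_ite_eq', Finset.sum_ite_eq', if_pos (by simp; omega),
          if_pos (by simp; omega)]
        have := sum_range_inv_le N
        nlinarith

lemma sum_range_truncKernel_le {β B : ℝ} {Q N : ℕ} (hQ : 1 ≤ Q) (hN : 1 ≤ N) (hB : 0 ≤ B)
    (hsp : ∀ h : ℕ, 1 ≤ h → h < Q → 1 / (N : ℝ) ≤ nearestIntDist (β * h)) (H : ℕ) :
    ∑ h ∈ Finset.range H, truncKernel B (β * h) ≤
      ((H : ℝ) / Q + 1) * (2 * B + 2 * N * (1 + Real.log N)) := by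
  have hblock : ∀ k : ℕ, ∑ h ∈ Finset.range (k * Q), truncKernel B (β * h) ≤
      k * (2 * B + 2 * N * (1 + Real.log N)) := by
    intro k
    induction k with
    | zero => simp
    | succ k ih =>
      rw [Nat.succ_mul, Finset.range_eq_Ico, ← Finset.sum_Ico_consecutive _ (Nat.zero_le (k * Q))
        (by omega), ← Finset.range_eq_Ico]
      have := sum_block_le (h₀ := k * Q) hN hB (fun h => truncKernel B (β * h))
        (fun h _ => truncKernel_nonneg hB _) (fun h _ => truncKernel_le _)
        (fun h _ => truncKernel_mul_le _ _) hsp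
      push_cast
      linarith
  have hsub : Finset.range H ⊆ Finset.range ((H / Q + 1) * Q) := by
    apply Finset.range_subset_range.mpr
    have := Nat.lt_div_mul_add (a := H) hQ
    rw [Nat.succ_mul]; omega
  refine (Finset.sum_le_sum_of_subset_of_nonneg hsub
    (fun _ _ _ => truncKernel_nonneg hB _)).trans ((hblock _).trans ?_)
  have hlog : 0 ≤ Real.log N := Real.log_natCast_nonneg N
  have : ((H / Q + 1 : ℕ) : ℝ) ≤ (H : ℝ) / Q + 1 := by
    push_cast; linarith [Nat.cast_div_le (α := ℝ) (m := H) (n := Q)]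
  gcongr

lemma sum_truncKernel_div_le {β x : ℝ} {Q N : ℕ} (hQ : 1 ≤ Q) (hN : 1 ≤ N) (hx : 0 ≤ x)
    (hsp : ∀ h : ℕ, 1 ≤ h → h < Q → 1 / (N : ℝ) ≤ nearestIntDist (β * h)) (M : ℕ) :
    ∑ m ∈ Finset.Ioc 0 M, truncKernel (x / m) (β * m) ≤
      2 * (x / Q) * (1 + Real.log (M + 1 : ℕ)) + (M / Q + 2) * (2 * N * (1 + Real.log N)) := by
  have hlogN : 0 ≤ Real.log N := Real.log_natCast_nonneg N
  have hQ0 : (0 : ℝ) < Q := by exact_mod_cast hQ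
  have hN0 : (1 : ℝ) ≤ N := by exact_mod_cast hN
  set φ : ℕ → ℝ := fun m => if m = 0 then 0 else truncKernel (x / m) (β * m) with hφ
  have hφ0 : ∀ m, 0 ≤ φ m := by
    intro m; simp only [hφ]; split_ifs
    · exact le_rfl
    · exact truncKernel_nonneg (by positivity) _
  have hφ1 : ∀ m : ℕ, φ m * nearestIntDist (β * m) ≤ 1 := by
    intro m; simp only [hφ]; split_ifs
    · simp
    · exact truncKernel_mul_le _ _
  have hfirst : ∑ m ∈ Finset.Ico 0 (0 + Q), φ m ≤ 2 * N + 2 * N * (1 + Real.log N) := by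
    refine sum_block_le hN (by positivity) φ (fun h _ => hφ0 h) ?_ (fun h _ => hφ1 h) hsp
    intro h hh
    rcases Nat.eq_zero_or_pos h with rfl | hpos
    · simp [hφ]
    · have h1 := hsp h hpos (by simpa using hh)
      have h2 := hφ1 h
      have h3 : φ h * (1 / N) ≤ 1 := (mul_le_mul_of_nonneg_left h1 (hφ0 h)).trans h2
      rwa [mul_one_div, div_le_one (by linarith)] at h3
  have hblock : ∀ k : ℕ, ∑ m ∈ Finset.range ((k + 1) * Q), φ m ≤
      2 * (x / Q) * (∑ j ∈ Finset.range (k + 1), ((j : ℝ))⁻¹) +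
        (k + 2) * (2 * N * (1 + Real.log N)) := by
    intro k
    induction k with
    | zero =>
      have h := hfirst
      simp only [zero_add, one_mul, ← Finset.range_eq_Ico] at h ⊢
      simp
      nlinarith
    | succ k ih =>
      rw [Nat.succ_mul (k + 1), Finset.range_eq_Ico,
        ← Finset.sum_Ico_consecutive _ (Nat.zero_le ((k + 1) * Q)) (by omega),
        ← Finset.range_eq_Ico]
      have hk : (0 : ℝ) < (k + 1 : ℕ) := by positivity
      have := sum_block_le (h₀ := (k + 1) * Q) (B := x / ((k + 1 : ℕ) * Q)) hN (by positivity) φ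
        (fun h _ => hφ0 h) (by
          intro h hh
          have hh1 : (k + 1) * Q ≤ h := (Finset.mem_Ico.mp hh).1
          have hh2 : h ≠ 0 := by
            have : 0 < (k + 1) * Q := by positivity
            omega
          simp only [hφ, if_neg hh2]
          refine (truncKernel_le _).trans ?_
          have : (((k + 1 : ℕ) : ℝ) * Q) ≤ h := by exact_mod_cast hh1
          gcongr) (fun h _ => hφ1 h) hsp
      rw [Finset.sum_range_succ _ (k + 1)]
      have e1 : 2 * (x / ((k + 1 : ℕ) * Q)) = 2 * (x / Q) * ((k + 1 : ℕ) : ℝ)⁻¹ := by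
        field_simp
      rw [e1] at this
      push_cast at this ih ⊢
      linarith
  have hsub : Finset.Ioc 0 M ⊆ Finset.range ((M / Q + 1) * Q) := by
    intro m hm
    have := Nat.lt_div_mul_add (a := M) hQ
    rw [Finset.mem_range, Nat.succ_mul]
    have := (Finset.mem_Ioc.mp hm).2
    omega
  have hcongr : ∑ m ∈ Finset.Ioc 0 M, truncKernel (x / m) (β * m) = ∑ m ∈ Finset.Ioc 0 M, φ m := by
    refine Finset.sum_congr rfl fun m hm => ?_
    simp only [hφ, if_neg (show m ≠ 0 by have := (Finset.mem_Ioc.mp hm).1; omega)]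
  rw [hcongr]
  refine (Finset.sum_le_sum_of_subset_of_nonneg hsub (fun m _ _ => hφ0 m)).trans
    ((hblock _).trans ?_)
  have h1 := sum_range_inv_le (M / Q + 1)
  have h2 : Real.log (M / Q + 1 : ℕ) ≤ Real.log (M + 1 : ℕ) := by
    apply Real.log_le_log (by positivity)
    exact_mod_cast Nat.succ_le_succ (Nat.div_le_self M Q)
  have h3 : ((M / Q : ℕ) : ℝ) ≤ (M : ℝ) / Q := Nat.cast_div_le
  have h4 := h1.trans (add_le_add_right h2 1)
  gcongr

lemma sum_truncKernel_sub_le {β B : ℝ} (hB : 0 ≤ B) {H n : ℕ} (hn : n ∈ Finset.Ioc 0 H) :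
    ∑ m ∈ Finset.Ioc 0 H, truncKernel B (β * ((n : ℝ) - m)) ≤
      2 * ∑ h ∈ Finset.range H, truncKernel B (β * h) := by
  have hn' := Finset.mem_Ioc.mp hn
  have key : ∀ (s : Finset ℕ) (g : ℕ → ℕ), Set.InjOn g s → (∀ m ∈ s, g m < H) →
      (∀ m ∈ s, truncKernel B (β * ((n : ℝ) - m)) = truncKernel B (β * (g m : ℕ))) →
      ∑ m ∈ s, truncKernel B (β * ((n : ℝ) - m)) ≤
        ∑ h ∈ Finset.range H, truncKernel B (β * h) := by
    intro s g hg hlt heq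
    rw [Finset.sum_congr rfl heq,
      ← Finset.sum_image (f := fun h : ℕ => truncKernel B (β * h)) hg]
    apply Finset.sum_le_sum_of_subset_of_nonneg
    · intro j hj
      obtain ⟨m, hm, rfl⟩ := Finset.mem_image.mp hj
      exact Finset.mem_range.mpr (hlt m hm)
    · intro j _ _; exact truncKernel_nonneg hB _
  rw [← Finset.sum_filter_add_sum_filter_not _ (fun m => m ≤ n), two_mul]
  refine add_le_add (key _ (fun m => n - m) ?_ ?_ ?_) (key _ (fun m => m - n) ?_ ?_ ?_)
  · intro a ha b hb hab
    simp at ha hb hab; omega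
  · intro m hm; simp at hm; omega
  · intro m hm
    simp at hm
    rw [Nat.cast_sub hm.2]
  · intro a ha b hb hab
    simp at ha hb hab; omega
  · intro m hm; simp at hm; omega
  · intro m hm
    simp at hm
    rw [Nat.cast_sub hm.2.le, ← truncKernel_neg]
    ring_nf

lemma norm_sum_e_mul_le {β : ℝ} {X B m n : ℕ} (hm : 0 < m) (hn : 0 < n) :
    ‖∑ b ∈ Finset.Ico B (2 * B), if b * m ≤ X ∧ b * n ≤ X then
      e (β * ((n : ℝ) - m) * b) else 0‖ ≤ truncKernel B (β * ((n : ℝ) - m)) := by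
  rw [← Finset.sum_filter]
  have : Finset.filter (fun b => b * m ≤ X ∧ b * n ≤ X) (Finset.Ico B (2 * B)) =
      Finset.Ico B (min (2 * B) (min (X / m) (X / n) + 1)) := by
    ext b
    simp only [Finset.mem_filter, Finset.mem_Ico, lt_min_iff, Nat.lt_succ_iff, le_min_iff,
      Nat.le_div_iff_mul_le hm, Nat.le_div_iff_mul_le hn]
    tauto
  rw [this]
  apply norm_sum_Ico_e_le
  exact_mod_cast (by omega :
    min (2 * B) (min (X / m) (X / n) + 1) - B ≤ B)

/-- Bilinear sum over one dyadic block: Cauchy–Schwarz in `b`, then expansion of the square. -/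
lemma norm_sq_bilinear_block_le {β ℓ : ℝ} {X B : ℕ} (hB : 0 < B) (a d : ℕ → ℂ)
    (ha : ∀ b, ‖a b‖ ≤ 1) (hd : ∀ m, 0 < m → m ≤ X → ‖d m‖ ≤ ℓ) :
    ‖∑ b ∈ Finset.Ico B (2 * B), a b * ∑ m ∈ Finset.Ioc 0 (X / b), d m * e (β * (b * m : ℕ))‖ ^ 2 ≤
      B * (ℓ ^ 2 * ((X / B : ℕ) * (2 * ∑ h ∈ Finset.range (X / B), truncKernel B (β * h)))) := by
  set H := X / B with hH
  set S : ℕ → ℂ := fun b => ∑ m ∈ Finset.Ioc 0 (X / b), d m * e (β * (b * m : ℕ)) with hS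
  have hHX : H ≤ X := Nat.div_le_self _ _
  have h1 : ‖∑ b ∈ Finset.Ico B (2 * B), a b * S b‖ ^ 2 ≤
      B * ∑ b ∈ Finset.Ico B (2 * B), ‖S b‖ ^ 2 := by
    have := sq_sum_le_card_mul_sum_sq (s := Finset.Ico B (2 * B)) (f := fun b => ‖S b‖)
    rw [Nat.card_Ico, show 2 * B - B = B by omega] at this
    refine le_trans ?_ this
    gcongr
    refine (norm_sum_le _ _).trans (Finset.sum_le_sum fun b _ => ?_)
    rw [norm_mul]
    exact mul_le_of_le_one_left (norm_nonneg _) (ha b)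
  refine h1.trans (mul_le_mul_of_nonneg_left ?_ (by positivity))
  have hSb : ∀ b ∈ Finset.Ico B (2 * B), S b =
      ∑ m ∈ Finset.Ioc 0 H, if b * m ≤ X then d m * e (β * (b * m : ℕ)) else 0 := by
    intro b hb
    have hb' := Finset.mem_Ico.mp hb
    rw [← Finset.sum_filter]
    refine Finset.sum_congr ?_ fun _ _ => rfl
    ext m
    simp only [Finset.mem_filter, Finset.mem_Ioc, Nat.le_div_iff_mul_le (show 0 < b by omega),
      hH, Nat.le_div_iff_mul_le hB]
    constructor
    · rintro ⟨p, q⟩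
      exact ⟨⟨p, (Nat.mul_le_mul_left m hb'.1).trans q⟩, by rwa [mul_comm]⟩
    · rintro ⟨⟨p, -⟩, q⟩
      exact ⟨p, by rwa [mul_comm]⟩
  have h2 : ((∑ b ∈ Finset.Ico B (2 * B), ‖S b‖ ^ 2 : ℝ) : ℂ) =
      ∑ n ∈ Finset.Ioc 0 H, ∑ m ∈ Finset.Ioc 0 H, d n * (starRingEnd ℂ) (d m) *
        ∑ b ∈ Finset.Ico B (2 * B), if b * m ≤ X ∧ b * n ≤ X then
          e (β * ((n : ℝ) - m) * b) else 0 := by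
    have : ∀ b ∈ Finset.Ico B (2 * B), ((‖S b‖ ^ 2 : ℝ) : ℂ) =
        ∑ n ∈ Finset.Ioc 0 H, ∑ m ∈ Finset.Ioc 0 H, d n * (starRingEnd ℂ) (d m) *
          if b * m ≤ X ∧ b * n ≤ X then e (β * ((n : ℝ) - m) * b) else 0 := by
      intro b hb
      rw [Complex.ofReal_pow, ← Complex.mul_conj', hSb b hb, map_sum, Finset.sum_mul_sum]
      refine Finset.sum_congr rfl fun n _ => Finset.sum_congr rfl fun m _ => ?_
      have he : e (β * ((n : ℝ) - m) * b) =
          e (β * (b * n : ℕ)) * (starRingEnd ℂ) (e (β * (b * m : ℕ))) := by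
        rw [← e_neg, ← e_add]; congr 1; push_cast; ring
      by_cases c1 : b * n ≤ X <;> by_cases c2 : b * m ≤ X <;> simp [c1, c2]
      rw [he]; push_cast; ring
    rw [Complex.ofReal_sum, Finset.sum_congr rfl this, Finset.sum_comm]
    refine Finset.sum_congr rfl fun n _ => ?_
    rw [Finset.sum_comm]
    refine Finset.sum_congr rfl fun m _ => ?_
    rw [Finset.mul_sum]
  have h3 : ∑ b ∈ Finset.Ico B (2 * B), ‖S b‖ ^ 2 =
      ‖((∑ b ∈ Finset.Ico B (2 * B), ‖S b‖ ^ 2 : ℝ) : ℂ)‖ := by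
    rw [Complex.norm_real, Real.norm_of_nonneg (by positivity)]
  rw [h3, h2]
  calc _ ≤ ∑ n ∈ Finset.Ioc 0 H, ∑ m ∈ Finset.Ioc 0 H,
        ℓ ^ 2 * truncKernel B (β * ((n : ℝ) - m)) := by
        refine (norm_sum_le _ _).trans (Finset.sum_le_sum fun n hn => ?_)
        refine (norm_sum_le _ _).trans (Finset.sum_le_sum fun m hm => ?_)
        have hn' := Finset.mem_Ioc.mp hn
        have hm' := Finset.mem_Ioc.mp hm
        have q1 := hd n hn'.1 (by omega)
        have q2 := hd m hm'.1 (by omega)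
        rw [norm_mul, norm_mul, RCLike.norm_conj, sq]
        have q3 := norm_sum_e_mul_le (β := β) (X := X) (B := B) hm'.1 hn'.1
        have q4 := (norm_nonneg (d n)).trans q1
        gcongr
    _ ≤ ∑ n ∈ Finset.Ioc 0 H, ℓ ^ 2 * (2 * ∑ h ∈ Finset.range H, truncKernel B (β * h)) := by
        refine Finset.sum_le_sum fun n hn => ?_
        rw [← Finset.mul_sum]
        exact mul_le_mul_of_nonneg_left (sum_truncKernel_sub_le (by positivity) hn) (by positivity)
    _ = _ := by
        rw [Finset.sum_const, Nat.card_Ioc, nsmul_eq_mul]; simp; ring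

lemma truncKernel_mono {B B' : ℝ} (h : B ≤ B') (θ : ℝ) : truncKernel B θ ≤ truncKernel B' θ :=
  le_truncKernel ((truncKernel_le θ).trans h) (truncKernel_mul_le B θ)

open scoped ArithmeticFunction.Moebius ArithmeticFunction.vonMangoldt ArithmeticFunction.zeta

/-- The restriction of an arithmetic function to arguments at most `U`. -/
noncomputable def arithTrunc (f : ArithmeticFunction ℝ) (U : ℕ) : ArithmeticFunction ℝ :=
  ⟨fun n => if n ≤ U then f n else 0, by simp⟩

lemma arithTrunc_apply (f : ArithmeticFunction ℝ) (U n : ℕ) :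
    arithTrunc f U n = if n ≤ U then f n else 0 := rfl

lemma ArithmeticFunction.sub_apply' (f h : ArithmeticFunction ℝ) (n : ℕ) :
    (f - h) n = f n - h n := by
  rw [sub_eq_add_neg, ArithmeticFunction.add_apply, sub_eq_add_neg]; rfl

lemma vaughan_identity (U : ℕ) :
    Λ = arithTrunc Λ U + arithTrunc (μ : ArithmeticFunction ℝ) U * ArithmeticFunction.log
      - arithTrunc (μ : ArithmeticFunction ℝ) U * arithTrunc Λ U * (ζ : ArithmeticFunction ℝ)
      + ((μ : ArithmeticFunction ℝ) - arithTrunc (μ : ArithmeticFunction ℝ) U) *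
        ((Λ - arithTrunc Λ U) * (ζ : ArithmeticFunction ℝ)) := by
  have h1 : (μ : ArithmeticFunction ℝ) * (ζ : ArithmeticFunction ℝ) = 1 :=
    ArithmeticFunction.coe_moebius_mul_coe_zeta
  have h2 : Λ * (ζ : ArithmeticFunction ℝ) = ArithmeticFunction.log :=
    ArithmeticFunction.vonMangoldt_mul_zeta
  linear_combination (arithTrunc Λ U - Λ) * h1 + arithTrunc (μ : ArithmeticFunction ℝ) U * h2

lemma sum_Ioc_mul_apply_mul (F G : ArithmeticFunction ℝ) (f : ℕ → ℂ) (N : ℕ) :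
    ∑ n ∈ Finset.Ioc 0 N, (((F * G) n : ℝ) : ℂ) * f n =
      ∑ b ∈ Finset.Ioc 0 N, (F b : ℂ) * ∑ m ∈ Finset.Ioc 0 (N / b), (G m : ℂ) * f (b * m) := by
  have h1 : ∀ n ∈ Finset.Ioc 0 N, (((F * G) n : ℝ) : ℂ) * f n =
      ∑ p ∈ n.divisorsAntidiagonal, (F p.1 : ℂ) * ((G p.2 : ℂ) * f (p.1 * p.2)) := by
    intro n _
    rw [ArithmeticFunction.mul_apply, Complex.ofReal_sum, Finset.sum_mul]
    refine Finset.sum_congr rfl fun p hp => ?_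
    rw [(Nat.mem_divisorsAntidiagonal.mp hp).1]; push_cast; ring
  rw [Finset.sum_congr rfl h1]
  simp_rw [Finset.mul_sum]
  rw [Finset.sum_sigma', Finset.sum_sigma']
  refine Finset.sum_bij' (fun p _ => ⟨p.2.1, p.2.2⟩) (fun p _ => ⟨p.1 * p.2, (p.1, p.2)⟩)
    ?_ ?_ ?_ ?_ ?_
  · rintro ⟨n, b, m⟩ h
    simp only [Finset.mem_sigma, Finset.mem_Ioc, Nat.mem_divisorsAntidiagonal] at h ⊢
    obtain ⟨⟨hn, hnN⟩, rfl, -⟩ := h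
    have hb : 0 < b := Nat.pos_of_mul_pos_right hn
    have hm : 0 < m := Nat.pos_of_mul_pos_left hn
    refine ⟨⟨hb, (Nat.le_mul_of_pos_right b hm).trans hnN⟩, hm, ?_⟩
    rw [Nat.le_div_iff_mul_le hb, mul_comm]; exact hnN
  · rintro ⟨b, m⟩ h
    simp only [Finset.mem_sigma, Finset.mem_Ioc, Nat.mem_divisorsAntidiagonal] at h ⊢
    obtain ⟨⟨hb, -⟩, hm, hmN⟩ := h
    rw [Nat.le_div_iff_mul_le hb, mul_comm] at hmN
    have := Nat.mul_pos hb hm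
    exact ⟨⟨this, hmN⟩, trivial, this.ne'⟩
  · rintro ⟨n, b, m⟩ h
    simp only [Finset.mem_sigma, Finset.mem_Ioc, Nat.mem_divisorsAntidiagonal] at h
    obtain ⟨-, rfl, -⟩ := h
    rfl
  · rintro ⟨b, m⟩ _; rfl
  · rintro ⟨n, b, m⟩ _; rfl

lemma abs_moebius_cast_le_one (n : ℕ) : |((μ n : ℤ) : ℝ)| ≤ 1 := by
  exact_mod_cast ArithmeticFunction.abs_moebius_le_one (n := n)

lemma abs_arithTrunc_moebius_le_one (U n : ℕ) :
    |arithTrunc (μ : ArithmeticFunction ℝ) U n| ≤ 1 := by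
  rw [arithTrunc_apply]
  split_ifs
  · exact abs_moebius_cast_le_one n
  · simp

lemma arithTrunc_vonMangoldt_nonneg (U n : ℕ) : 0 ≤ arithTrunc Λ U n := by
  rw [arithTrunc_apply]
  split_ifs
  · exact ArithmeticFunction.vonMangoldt_nonneg
  · exact le_rfl

lemma arithTrunc_vonMangoldt_le (U n : ℕ) : arithTrunc Λ U n ≤ Λ n := by
  rw [arithTrunc_apply]
  split_ifs
  · exact le_rfl
  · exact ArithmeticFunction.vonMangoldt_nonneg

lemma abs_arithTrunc_mul_arithTrunc_le (U n : ℕ) :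
    |(arithTrunc (μ : ArithmeticFunction ℝ) U * arithTrunc Λ U) n| ≤ Real.log n := by
  rw [ArithmeticFunction.mul_apply, ← ArithmeticFunction.vonMangoldt_sum,
    ← Nat.sum_divisorsAntidiagonal' (fun _ d => Λ d)]
  refine (Finset.abs_sum_le_sum_abs _ _).trans (Finset.sum_le_sum fun p _ => ?_)
  rw [abs_mul, abs_of_nonneg (arithTrunc_vonMangoldt_nonneg U p.2)]
  have h1 := abs_arithTrunc_moebius_le_one U p.1
  have h2 := arithTrunc_vonMangoldt_nonneg U p.2
  have h3 := arithTrunc_vonMangoldt_le U p.2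
  nlinarith

lemma arithTrunc_mul_arithTrunc_eq_zero (f h : ArithmeticFunction ℝ) {U n : ℕ} (hn : U * U < n) :
    (arithTrunc f U * arithTrunc h U) n = 0 := by
  rw [ArithmeticFunction.mul_apply]
  refine Finset.sum_eq_zero fun p hp => ?_
  have hp' := (Nat.mem_divisorsAntidiagonal.mp hp).1
  rw [arithTrunc_apply, arithTrunc_apply]
  by_cases h1 : p.1 ≤ U
  · by_cases h2 : p.2 ≤ U
    · have := Nat.mul_le_mul h1 h2
      omega
    · simp [h2]
  · simp [h1]

lemma tail_vonMangoldt_mul_zeta_abs_le (U n : ℕ) :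
    |((Λ - arithTrunc Λ U) * (ζ : ArithmeticFunction ℝ)) n| ≤ Real.log n := by
  rw [ArithmeticFunction.coe_mul_zeta_apply, ← ArithmeticFunction.vonMangoldt_sum]
  refine (Finset.abs_sum_le_sum_abs _ _).trans (Finset.sum_le_sum fun d _ => ?_)
  rw [ArithmeticFunction.sub_apply', abs_of_nonneg (by linarith [arithTrunc_vonMangoldt_le U d])]
  linarith [arithTrunc_vonMangoldt_nonneg U d]

lemma tail_vonMangoldt_mul_zeta_eq_zero {U n : ℕ} (hn : n ≤ U) :
    ((Λ - arithTrunc Λ U) * (ζ : ArithmeticFunction ℝ)) n = 0 := by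
  rw [ArithmeticFunction.coe_mul_zeta_apply]
  refine Finset.sum_eq_zero fun d hd => ?_
  rw [ArithmeticFunction.sub_apply', arithTrunc_apply,
    if_pos ((Nat.divisor_le hd).trans hn), sub_self]

lemma tail_moebius_abs_le_one (U n : ℕ) :
    |((μ : ArithmeticFunction ℝ) - arithTrunc (μ : ArithmeticFunction ℝ) U) n| ≤ 1 := by
  rw [ArithmeticFunction.sub_apply', arithTrunc_apply]
  split_ifs
  · simp
  · simpa using abs_moebius_cast_le_one n

lemma tail_moebius_eq_zero {U n : ℕ} (hn : n ≤ U) :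
    ((μ : ArithmeticFunction ℝ) - arithTrunc (μ : ArithmeticFunction ℝ) U) n = 0 := by
  rw [ArithmeticFunction.sub_apply', arithTrunc_apply, if_pos hn, sub_self]

/-- Linear sums: the inner sum over the smooth variable is controlled by the kernel. -/
lemma norm_linear_sum_le {β x c c' : ℝ} {X M : ℕ} (F G : ArithmeticFunction ℝ)
    (hx : 0 ≤ x) (hc : 0 ≤ c) (hc' : 0 ≤ c')
    (hF0 : ∀ b, M < b → F b = 0) (hF : ∀ b, 0 < b → b ≤ X → |F b| ≤ c)
    (hG : ∀ b, 0 < b → b ≤ X → ‖∑ m ∈ Finset.Ioc 0 (X / b), (G m : ℂ) * e (β * (b * m : ℕ))‖ ≤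
      c' * truncKernel (x / b) (β * b)) :
    ‖∑ n ∈ Finset.Ioc 0 X, (((F * G) n : ℝ) : ℂ) * e (β * n)‖ ≤
      c * c' * ∑ b ∈ Finset.Ioc 0 M, truncKernel (x / b) (β * b) := by
  have hk : ∀ b : ℕ, 0 ≤ truncKernel (x / b) (β * b) := fun b =>
    truncKernel_nonneg (by positivity) _
  rw [sum_Ioc_mul_apply_mul F G (fun n => e (β * n)) X, Finset.mul_sum]
  calc _ ≤ ∑ b ∈ Finset.Ioc 0 X, if b ≤ M then c * c' * truncKernel (x / b) (β * b) else 0 := by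
        refine (norm_sum_le _ _).trans (Finset.sum_le_sum fun b hb => ?_)
        obtain ⟨hb0, hbX⟩ := Finset.mem_Ioc.mp hb
        split_ifs with h
        · rw [norm_mul, Complex.norm_real, Real.norm_eq_abs, mul_assoc]
          exact mul_le_mul (hF b hb0 hbX) (hG b hb0 hbX) (norm_nonneg _) hc
        · rw [hF0 b (by omega)]; simp
    _ ≤ _ := by
        rw [← Finset.sum_filter]
        apply Finset.sum_le_sum_of_subset_of_nonneg
        · intro b hb
          simp only [Finset.mem_filter, Finset.mem_Ioc] at hb ⊢
          exact ⟨hb.1.1, hb.2⟩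
        · intro b _ _
          exact mul_nonneg (mul_nonneg hc hc') (hk b)

lemma sum_Ico_two_pow {E : Type*} [AddCommMonoid E] (f : ℕ → E) (J : ℕ) :
    ∑ b ∈ Finset.Ico 1 (2 ^ J), f b =
      ∑ j ∈ Finset.range J, ∑ b ∈ Finset.Ico (2 ^ j) (2 * 2 ^ j), f b := by
  induction J with
  | zero => simp
  | succ J ih =>
    rw [Finset.sum_range_succ, ← ih, ← Finset.sum_Ico_consecutive f (Nat.one_le_two_pow (n := J))
      (Nat.pow_le_pow_right two_pos (Nat.le_succ J)), pow_succ, mul_comm (2 ^ J) 2]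

/-- A dyadic block of the bilinear sum, in terms of the final error term `W`. -/
lemma norm_bilinear_block_le {β x y ℓ W D : ℝ} {Q N U B : ℕ} (hx : 1 ≤ x) (hy : 0 < y)
    (hℓ : 1 ≤ ℓ) (hD : 1 ≤ D) (hW : 0 ≤ W) (hQ : 1 ≤ Q) (hN : 1 ≤ N)
    (hNQ : (N : ℝ) * (1 + Real.log N) ≤ D ^ 2 * Q * ℓ)
    (hU : y < U + 1) (hB : 0 < B)
    (hWx : x ^ 2 / Q + x ^ 2 / y + x * Q ≤ W ^ 2)
    (hsp : ∀ h : ℕ, 1 ≤ h → h < Q → 1 / (N : ℝ) ≤ nearestIntDist (β * h))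
    (a d : ℕ → ℂ) (ha : ∀ b, ‖a b‖ ≤ 1) (ha0 : ∀ b, b ≤ U → a b = 0)
    (hd : ∀ m, 0 < m → m ≤ ⌊x⌋₊ → ‖d m‖ ≤ ℓ) (hd0 : ∀ m, m ≤ U → d m = 0) :
    ‖∑ b ∈ Finset.Ico B (2 * B), a b *
      ∑ m ∈ Finset.Ioc 0 (⌊x⌋₊ / b), d m * e (β * (b * m : ℕ))‖ ≤ 4 * D * ℓ ^ 2 * W := by
  have hrhs : 0 ≤ 4 * D * ℓ ^ 2 * W := by positivity
  by_cases h1 : 2 * B ≤ U + 1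
  · rw [Finset.sum_eq_zero]
    · simpa using hrhs
    · intro b hb
      rw [ha0 b (by have := (Finset.mem_Ico.mp hb).2; omega), zero_mul]
  by_cases h2 : ⌊x⌋₊ / B ≤ U
  · rw [Finset.sum_eq_zero]
    · simpa using hrhs
    · intro b hb
      rw [Finset.sum_eq_zero, mul_zero]
      intro m hm
      have h3 := (Finset.mem_Ioc.mp hm).2
      have h4 : ⌊x⌋₊ / b ≤ ⌊x⌋₊ / B := Nat.div_le_div_left (Finset.mem_Ico.mp hb).1 hB
      rw [hd0 m (by omega), zero_mul]
  have hx0 : 0 < x := by linarith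
  have hB0 : (0 : ℝ) < B := by exact_mod_cast hB
  have hQ0 : (1 : ℝ) ≤ Q := by exact_mod_cast hQ
  have hyB : y ≤ 2 * B := by
    have : ((U + 1 : ℕ) : ℝ) ≤ (2 * B : ℕ) := by exact_mod_cast (by omega : U + 1 ≤ 2 * B)
    push_cast at this; linarith
  set H : ℕ := ⌊x⌋₊ / B with hH
  have hHB : (B : ℝ) * H ≤ x := by
    have h3 : ((B * H : ℕ) : ℝ) ≤ (⌊x⌋₊ : ℕ) := by exact_mod_cast Nat.mul_div_le _ _
    push_cast at h3
    exact h3.trans (Nat.floor_le hx0.le)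
  have hyH : y ≤ H := by
    have : ((U + 1 : ℕ) : ℝ) ≤ H := by exact_mod_cast (by omega : U + 1 ≤ H)
    push_cast at this; linarith
  have hH0 : (0 : ℝ) < H := hy.trans_le hyH
  have hBx : (B : ℝ) ≤ x / y := by
    rw [le_div_iff₀ hy]; nlinarith
  have hHx : (H : ℝ) ≤ 2 * (x / y) := by
    rw [← mul_div_assoc, le_div_iff₀ hy]; nlinarith
  have key := norm_sq_bilinear_block_le (β := β) hB a d ha hd
  have hsum := sum_range_truncKernel_le (B := (B : ℝ)) hQ hN hB0.le hsp H
  refine abs_le_of_sq_le_sq' (key.trans ?_) hrhs |>.2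
  have hD2 : 1 ≤ D ^ 2 := one_le_pow₀ hD
  have hDℓ : 1 ≤ D ^ 2 * ℓ := one_le_mul_of_one_le_of_one_le hD2 hℓ
  have hfac : ((H : ℝ) / Q + 1) * (2 * B + 2 * N * (1 + Real.log N)) ≤
      2 * (D ^ 2 * ℓ) * (x / Q + 3 * (x / y) + Q) := by
    have e1 : ((H : ℝ) / Q + 1) * (2 * B + 2 * N * (1 + Real.log N)) ≤
        ((H : ℝ) / Q + 1) * (2 * (D ^ 2 * ℓ) * B + 2 * (D ^ 2 * ℓ) * Q) := by
      apply mul_le_mul_of_nonneg_left _ (by positivity)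
      nlinarith
    have e2 : ((H : ℝ) / Q + 1) * (2 * (D ^ 2 * ℓ) * B + 2 * (D ^ 2 * ℓ) * Q) =
        2 * (D ^ 2 * ℓ) * (B * H / Q + H + B + Q) := by
      field_simp; ring
    rw [e2] at e1
    refine e1.trans (mul_le_mul_of_nonneg_left ?_ (by positivity))
    have e3 : (B : ℝ) * H / Q ≤ x / Q := by gcongr
    linarith
  have hpoly : x * (x / Q + 3 * (x / y) + Q) ≤ 3 * W ^ 2 := by
    have e1 : x * (x / Q + 3 * (x / y) + Q) = x ^ 2 / Q + 3 * (x ^ 2 / y) + x * Q := by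
      field_simp
    have e2 : 0 ≤ x ^ 2 / Q := by positivity
    have e3 : 0 ≤ x * Q := by positivity
    rw [e1]; linarith
  calc (B : ℝ) * (ℓ ^ 2 * (H * (2 * ∑ h ∈ Finset.range H, truncKernel B (β * h))))
      = 2 * ℓ ^ 2 * (B * H) * ∑ h ∈ Finset.range H, truncKernel B (β * h) := by ring
    _ ≤ 2 * ℓ ^ 2 * x * (2 * (D ^ 2 * ℓ) * (x / Q + 3 * (x / y) + Q)) := by
        have h0 : 0 ≤ ∑ h ∈ Finset.range H, truncKernel (B : ℝ) (β * h) :=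
          Finset.sum_nonneg fun h _ => truncKernel_nonneg hB0.le _
        have h1 := hsum.trans hfac
        gcongr
    _ = 4 * D ^ 2 * ℓ ^ 3 * (x * (x / Q + 3 * (x / y) + Q)) := by ring
    _ ≤ 4 * D ^ 2 * ℓ ^ 3 * (3 * W ^ 2) := by gcongr
    _ ≤ (4 * D * ℓ ^ 2 * W) ^ 2 := by
        have h3 : ℓ ^ 3 ≤ ℓ ^ 4 := pow_le_pow_right₀ hℓ (by norm_num)
        have h4 : 0 ≤ D ^ 2 * W ^ 2 := by positivity
        have h5 : 0 ≤ ℓ ^ 3 := by positivity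
        nlinarith

lemma norm_bilinear_sum_le {β x y ℓ W D : ℝ} {Q N U : ℕ} (hx : 1 ≤ x) (hy : 0 < y)
    (hℓ : ℓ = 1 + Real.log x) (hD : 1 ≤ D) (hW : 0 ≤ W) (hQ : 1 ≤ Q) (hN : 1 ≤ N)
    (hNQ : (N : ℝ) * (1 + Real.log N) ≤ D ^ 2 * Q * ℓ) (hU : y < U + 1)
    (hWx : x ^ 2 / Q + x ^ 2 / y + x * Q ≤ W ^ 2)
    (hsp : ∀ h : ℕ, 1 ≤ h → h < Q → 1 / (N : ℝ) ≤ nearestIntDist (β * h))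
    (a d : ℕ → ℂ) (ha : ∀ b, ‖a b‖ ≤ 1) (ha0 : ∀ b, b ≤ U → a b = 0)
    (hd : ∀ m, 0 < m → m ≤ ⌊x⌋₊ → ‖d m‖ ≤ ℓ) (hd0 : ∀ m, m ≤ U → d m = 0) :
    ‖∑ b ∈ Finset.Ioc 0 ⌊x⌋₊, a b *
      ∑ m ∈ Finset.Ioc 0 (⌊x⌋₊ / b), d m * e (β * (b * m : ℕ))‖ ≤ 8 * D * ℓ ^ 3 * W := by
  have hlog : 0 ≤ Real.log x := Real.log_nonneg hx
  set X := ⌊x⌋₊ with hX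
  set J := Nat.log 2 X + 1 with hJ
  set f : ℕ → ℂ := fun b => a b * ∑ m ∈ Finset.Ioc 0 (X / b), d m * e (β * (b * m : ℕ)) with hf
  have hX1 : 1 ≤ X := Nat.le_floor (by simpa using hx)
  have hXx : (X : ℝ) ≤ x := Nat.floor_le (by linarith)
  have hlt : X < 2 ^ J := Nat.lt_pow_succ_log_self (by norm_num) X
  have hdy : ∑ b ∈ Finset.Ioc 0 X, f b = ∑ b ∈ Finset.Ico 1 (2 ^ J), f b := by
    apply Finset.sum_subset
    · intro b hb
      simp only [Finset.mem_Ioc, Finset.mem_Ico] at hb ⊢; omega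
    · intro b hb hb'
      simp only [Finset.mem_Ioc, Finset.mem_Ico] at hb hb'
      simp [hf, Nat.div_eq_of_lt (show X < b by omega)]
  have hJℓ : (J : ℝ) ≤ 2 * ℓ := by
    have h1 : ((2 ^ Nat.log 2 X : ℕ) : ℝ) ≤ x :=
      le_trans (by exact_mod_cast Nat.pow_log_le_self 2 (by omega)) hXx
    have h2 := Real.log_le_log (by positivity) h1
    push_cast at h2
    rw [Real.log_pow] at h2
    have h3 := Real.log_two_gt_d9
    have h4 : (0 : ℝ) ≤ Nat.log 2 X := by positivity
    have h5 : (Nat.log 2 X : ℝ) ≤ 2 * Real.log x := by nlinarith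
    rw [hJ]; push_cast; linarith
  rw [hdy, sum_Ico_two_pow]
  calc _ ≤ ∑ j ∈ Finset.range J, 4 * D * ℓ ^ 2 * W := by
        refine (norm_sum_le _ _).trans (Finset.sum_le_sum fun j _ => ?_)
        exact norm_bilinear_block_le hx hy (by linarith) hD hW hQ hN hNQ hU (by positivity) hWx hsp
          a d ha ha0 hd hd0
    _ = J * (4 * D * ℓ ^ 2 * W) := by simp
    _ ≤ 2 * ℓ * (4 * D * ℓ ^ 2 * W) := by gcongr
    _ = _ := by ring

lemma sum_truncKernel_div_le_error {β x ℓ W D : ℝ} {Q N M : ℕ} (hx : 1 ≤ x)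
    (hℓ : ℓ = 1 + Real.log x) (hD : 1 ≤ D) (hQ : 1 ≤ Q) (hN : 1 ≤ N)
    (hNQ : (N : ℝ) * (1 + Real.log N) ≤ D ^ 2 * Q * ℓ)
    (hsp : ∀ h : ℕ, 1 ≤ h → h < Q → 1 / (N : ℝ) ≤ nearestIntDist (β * h))
    (hMx : (M : ℝ) ≤ x) (hM : (M : ℝ) ≤ W) (hQW : (Q : ℝ) ≤ W) (hxW : x / Q ≤ W) :
    ∑ m ∈ Finset.Ioc 0 M, truncKernel (x / m) (β * m) ≤ 10 * D ^ 2 * ℓ * W := by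
  have hlog : 0 ≤ Real.log x := Real.log_nonneg hx
  have hQ0 : (1 : ℝ) ≤ Q := by exact_mod_cast hQ
  have hM1 : Real.log (M + 1 : ℕ) ≤ ℓ := by
    have h1 : Real.log (M + 1 : ℕ) ≤ Real.log (2 * x) := by
      apply Real.log_le_log (by positivity); push_cast; linarith
    rw [Real.log_mul (by norm_num) (by linarith)] at h1
    linarith [Real.log_two_lt_d9]
  refine (sum_truncKernel_div_le hQ hN (by linarith) hsp M).trans ?_
  have hℓ1 : 1 ≤ ℓ := by linarith
  have hW : 0 ≤ W := by linarith
  have hD2 : 1 ≤ D ^ 2 := one_le_pow₀ hD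
  have e1 : 2 * (x / Q) * (1 + Real.log (M + 1 : ℕ)) ≤ 2 * W * (2 * ℓ) := by
    have : 0 ≤ Real.log (M + 1 : ℕ) := Real.log_natCast_nonneg _
    gcongr; linarith
  have e2 : ((M : ℝ) / Q + 2) * (2 * N * (1 + Real.log N)) ≤ 6 * D ^ 2 * ℓ * W := by
    calc ((M : ℝ) / Q + 2) * (2 * N * (1 + Real.log N))
        ≤ ((M : ℝ) / Q + 2) * (2 * (D ^ 2 * Q * ℓ)) := by
          apply mul_le_mul_of_nonneg_left _ (by positivity); linarith
      _ = 2 * (D ^ 2 * ℓ) * (M + 2 * Q) := by field_simp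
      _ ≤ 2 * (D ^ 2 * ℓ) * (W + 2 * W) := by gcongr
      _ = _ := by ring
  have e3 : 4 * ℓ * W ≤ 4 * D ^ 2 * ℓ * W := by
    have : 0 ≤ ℓ * W := by positivity
    nlinarith
  linarith

/-- The exponential sum over `Λ` for a frequency whose multiples below `Q` stay away from the
integers. -/
lemma norm_sum_vonMangoldt_e_le {β x y ℓ W D : ℝ} {Q N : ℕ} (hx : 1 ≤ x) (hy : 0 < y)
    (hyx : y ^ 5 = x ^ 2)
    (hℓ : ℓ = 1 + Real.log x) (hD : 1 ≤ D) (hW : 0 ≤ W) (hQ : 1 ≤ Q) (hN : 1 ≤ N) (hQx : (Q : ℝ) ≤ x)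
    (hNQ : (N : ℝ) * (1 + Real.log N) ≤ D ^ 2 * Q * ℓ)
    (hWx : x ^ 2 / Q + x ^ 2 / y + x * Q ≤ W ^ 2)
    (hsp : ∀ h : ℕ, 1 ≤ h → h < Q → 1 / (N : ℝ) ≤ nearestIntDist (β * h)) :
    ‖∑ n ∈ Finset.Ioc 0 ⌊x⌋₊, (Λ n : ℂ) * e (β * n)‖ ≤ 29 * D ^ 2 * ℓ ^ 3 * W := by
  have hlog : 0 ≤ Real.log x := Real.log_nonneg hx
  have hQ0 : (1 : ℝ) ≤ Q := by exact_mod_cast hQ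
  have hx0 : 0 < x := by linarith
  set U := ⌊y⌋₊ with hUdef
  have hUy : (U : ℝ) ≤ y := Nat.floor_le hy.le
  have hU : y < U + 1 := Nat.lt_floor_add_one y
  have p1 : 0 ≤ x ^ 2 / Q := by positivity
  have p2 : 0 ≤ x ^ 2 / y := by positivity
  have p3 : 0 ≤ x * Q := by positivity
  have hUU : ((U * U : ℕ) : ℝ) ≤ y ^ 2 := by push_cast; nlinarith [(Nat.cast_nonneg U : (0:ℝ) ≤ U)]
  have hU1 : (U : ℝ) ≤ (U * U : ℕ) := by exact_mod_cast Nat.le_mul_self U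
  have hyW : y ^ 2 ≤ W := by
    refine abs_le_of_sq_le_sq' ?_ hW |>.2
    have : x ^ 2 / y = (y ^ 2) ^ 2 := by rw [← hyx]; field_simp
    linarith
  have hy2x : y ^ 2 ≤ x := by
    refine le_of_pow_le_pow_left₀ (n := 5) (by norm_num) hx0.le ?_
    calc (y ^ 2) ^ 5 = x ^ 4 := by rw [← pow_mul, mul_comm, pow_mul, hyx]; ring
      _ ≤ x ^ 5 := pow_le_pow_right₀ hx (by norm_num)
  have hQW : (Q : ℝ) ≤ W := by
    refine abs_le_of_sq_le_sq' ?_ hW |>.2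
    nlinarith
  have hxW : x / Q ≤ W := by
    refine abs_le_of_sq_le_sq' ?_ hW |>.2
    have : (x / Q) ^ 2 ≤ x ^ 2 / Q := by
      rw [div_pow]
      gcongr
      nlinarith
    linarith
  have hℓ1 : 1 ≤ ℓ := by linarith
  have hXx : ((⌊x⌋₊ : ℕ) : ℝ) ≤ x := Nat.floor_le hx0.le
  have hlogn : ∀ n : ℕ, 0 < n → n ≤ ⌊x⌋₊ → Real.log n ≤ Real.log x := by
    intro n h0 hn
    apply Real.log_le_log (by exact_mod_cast h0)
    exact le_trans (by exact_mod_cast hn) hXx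
  have hdiv : ∀ b : ℕ, ((⌊x⌋₊ / b : ℕ) : ℝ) ≤ x / b := fun b =>
    Nat.cast_div_le.trans (by gcongr)
  -- the initial segment
  have t1 : ‖∑ n ∈ Finset.Ioc 0 ⌊x⌋₊, (arithTrunc Λ U n : ℂ) * e (β * n)‖ ≤ Real.log x * W := by
    calc _ ≤ ∑ n ∈ Finset.Ioc 0 ⌊x⌋₊, if n ≤ U then Real.log x else 0 := by
          refine (norm_sum_le _ _).trans (Finset.sum_le_sum fun n hn => ?_)
          obtain ⟨h0, hn⟩ := Finset.mem_Ioc.mp hn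
          rw [norm_mul, norm_e, mul_one, Complex.norm_real,
            Real.norm_of_nonneg (arithTrunc_vonMangoldt_nonneg U n), arithTrunc_apply]
          split_ifs
          · exact ArithmeticFunction.vonMangoldt_le_log.trans (hlogn n h0 hn)
          · exact le_rfl
      _ ≤ ∑ n ∈ Finset.Ioc 0 U, Real.log x := by
          rw [← Finset.sum_filter]
          apply Finset.sum_le_sum_of_subset_of_nonneg
          · intro b hb
            simp only [Finset.mem_filter, Finset.mem_Ioc] at hb ⊢
            exact ⟨hb.1.1, hb.2⟩
          · intro _ _ _; exact hlog
      _ = Real.log x * U := by simp [mul_comm]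
      _ ≤ Real.log x * W := by gcongr; linarith
  -- the sums with a smooth variable
  have t2 := norm_linear_sum_le (β := β) (x := x) (c := 1) (c' := Real.log x) (X := ⌊x⌋₊) (M := U)
    (arithTrunc (μ : ArithmeticFunction ℝ) U) ArithmeticFunction.log hx0.le zero_le_one hlog
    (fun b hb => by rw [arithTrunc_apply, if_neg (by omega)])
    (fun b _ _ => abs_arithTrunc_moebius_le_one U b)
    (by
      intro b hb hbX
      have h1 := norm_sum_log_mul_e_le (β * b) (⌊x⌋₊ / b)
      have h2 : ∀ m ∈ Finset.Ioc 0 (⌊x⌋₊ / b), (ArithmeticFunction.log m : ℂ) *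
          e (β * (b * m : ℕ)) = (Real.log m : ℂ) * e (β * b * m) := by
        intro m _
        rw [ArithmeticFunction.log_apply]; push_cast; rw [mul_assoc β]
      rw [Finset.sum_congr rfl h2]
      refine h1.trans (mul_le_mul (hlogn _ ?_ (Nat.div_le_self _ _))
        (truncKernel_mono (hdiv b) _) (truncKernel_nonneg (by positivity) _) hlog)
      exact Nat.div_pos hbX hb)
  have t3 := norm_linear_sum_le (β := β) (x := x) (c := Real.log x) (c' := 1) (X := ⌊x⌋₊)
    (M := U * U) (arithTrunc (μ : ArithmeticFunction ℝ) U * arithTrunc Λ U)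
    (ζ : ArithmeticFunction ℝ) hx0.le hlog zero_le_one
    (fun b hb => arithTrunc_mul_arithTrunc_eq_zero _ _ hb)
    (fun b hb hbX => (abs_arithTrunc_mul_arithTrunc_le U b).trans (hlogn b hb hbX))
    (by
      intro b hb hbX
      have h2 : ∀ m ∈ Finset.Ioc 0 (⌊x⌋₊ / b), (((ζ : ArithmeticFunction ℝ) m : ℝ) : ℂ) *
          e (β * (b * m : ℕ)) = e (β * b * m) := by
        intro m hm
        rw [ArithmeticFunction.natCoe_apply, ArithmeticFunction.zeta_apply_ne
          (by have := (Finset.mem_Ioc.mp hm).1; omega)]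
        push_cast; rw [one_mul, mul_assoc β]
      rw [Finset.sum_congr rfl h2, one_mul,
        show Finset.Ioc 0 (⌊x⌋₊ / b) = Finset.Ico 1 (⌊x⌋₊ / b + 1) by
          ext; simp only [Finset.mem_Ioc, Finset.mem_Ico]; omega]
      apply norm_sum_Ico_e_le
      simpa using hdiv b)
  -- the bilinear sum
  have t4 := norm_bilinear_sum_le (β := β) hx hy hℓ hD hW hQ hN hNQ hU hWx hsp
    (fun b => ((((μ : ArithmeticFunction ℝ) - arithTrunc (μ : ArithmeticFunction ℝ) U) b : ℝ) : ℂ))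
    (fun m => ((((Λ - arithTrunc Λ U) * (ζ : ArithmeticFunction ℝ)) m : ℝ) : ℂ))
    (fun b => by
      rw [Complex.norm_real]; exact tail_moebius_abs_le_one U b)
    (fun b hb => by rw [tail_moebius_eq_zero hb]; simp)
    (fun m hm hmX => by
      rw [Complex.norm_real]
      refine (tail_vonMangoldt_mul_zeta_abs_le U m).trans ((hlogn m hm hmX).trans (by linarith)))
    (fun m hm => by rw [tail_vonMangoldt_mul_zeta_eq_zero hm]; simp)
  rw [← sum_Ioc_mul_apply_mul _ _ (fun n => e (β * n))] at t4
  have s2 := sum_truncKernel_div_le_error (M := U) hx hℓ hD hQ hN hNQ hsp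
    (by linarith) (by linarith) hQW hxW
  have s3 := sum_truncKernel_div_le_error (M := U * U) hx hℓ hD hQ hN hNQ hsp
    (by linarith) (by linarith) hQW hxW
  have hdecomp : ∑ n ∈ Finset.Ioc 0 ⌊x⌋₊, (Λ n : ℂ) * e (β * n) =
      ∑ n ∈ Finset.Ioc 0 ⌊x⌋₊, (arithTrunc Λ U n : ℂ) * e (β * n)
      + ∑ n ∈ Finset.Ioc 0 ⌊x⌋₊, (((arithTrunc (μ : ArithmeticFunction ℝ) U *
          ArithmeticFunction.log) n : ℝ) : ℂ) * e (β * n)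
      - ∑ n ∈ Finset.Ioc 0 ⌊x⌋₊, (((arithTrunc (μ : ArithmeticFunction ℝ) U * arithTrunc Λ U *
          (ζ : ArithmeticFunction ℝ)) n : ℝ) : ℂ) * e (β * n)
      + ∑ n ∈ Finset.Ioc 0 ⌊x⌋₊, (((((μ : ArithmeticFunction ℝ) -
          arithTrunc (μ : ArithmeticFunction ℝ) U) *
          ((Λ - arithTrunc Λ U) * (ζ : ArithmeticFunction ℝ))) n : ℝ) : ℂ) * e (β * n) := by
    rw [← Finset.sum_add_distrib, ← Finset.sum_sub_distrib, ← Finset.sum_add_distrib]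
    refine Finset.sum_congr rfl fun n _ => ?_
    conv_lhs => rw [vaughan_identity U]
    rw [ArithmeticFunction.add_apply, ArithmeticFunction.sub_apply', ArithmeticFunction.add_apply]
    push_cast; ring
  rw [hdecomp]
  have hlogℓ : Real.log x ≤ ℓ := by linarith
  have b1 : Real.log x * W ≤ D ^ 2 * ℓ ^ 3 * W := by
    have : Real.log x ≤ D ^ 2 * ℓ ^ 3 := by
      calc Real.log x ≤ 1 * ℓ := by linarith
        _ ≤ D ^ 2 * ℓ ^ 3 := mul_le_mul (one_le_pow₀ hD) (le_self_pow₀ hℓ1 (by norm_num))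
            (by positivity) (by positivity)
    gcongr
  have b2 : Real.log x * (10 * D ^ 2 * ℓ * W) ≤ 10 * (D ^ 2 * ℓ ^ 3 * W) := by
    calc Real.log x * (10 * D ^ 2 * ℓ * W) ≤ ℓ ^ 2 * (10 * D ^ 2 * ℓ * W) :=
          mul_le_mul_of_nonneg_right (hlogℓ.trans (le_self_pow₀ hℓ1 (by norm_num))) (by positivity)
      _ = _ := by ring
  have b3 : 8 * D * ℓ ^ 3 * W ≤ 8 * (D ^ 2 * ℓ ^ 3 * W) := by
    calc 8 * D * ℓ ^ 3 * W = D * (8 * (ℓ ^ 3 * W)) := by ring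
      _ ≤ D ^ 2 * (8 * (ℓ ^ 3 * W)) :=
          mul_le_mul_of_nonneg_right (le_self_pow₀ hD (by norm_num)) (by positivity)
      _ = _ := by ring
  have c2 := mul_le_mul_of_nonneg_left s2 hlog
  have c3 := mul_le_mul_of_nonneg_left s3 hlog
  rw [one_mul] at t2
  rw [mul_one] at t3
  refine (norm_add_le _ _).trans ?_
  refine (add_le_add_left (norm_sub_le _ _) _).trans ?_
  refine (add_le_add_left (add_le_add_left (norm_add_le _ _) _) _).trans ?_
  linarith

lemma norm_sum_prime_sub_vonMangoldt_le {x : ℝ} (hx : 1 ≤ x) (β : ℝ) :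
    ‖∑ n ∈ Finset.Ioc 0 ⌊x⌋₊, (if n.Prime then (Real.log n : ℂ) * e (β * n) else 0)
      - ∑ n ∈ Finset.Ioc 0 ⌊x⌋₊, (Λ n : ℂ) * e (β * n)‖ ≤ 2 * √x * Real.log x := by
  refine le_trans ?_ (Chebyshev.psi_sub_theta_le hx)
  rw [Chebyshev.psi_sub_theta_eq_sum_not_prime, Finset.sum_filter, ← Finset.sum_sub_distrib]
  refine (norm_sum_le _ _).trans (Finset.sum_le_sum fun n _ => ?_)
  by_cases h : n.Prime
  · simp [h, ArithmeticFunction.vonMangoldt_apply_prime]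
  · simp [h, norm_e, abs_of_nonneg ArithmeticFunction.vonMangoldt_nonneg]

lemma sum_range_e_eq_ite {g : ℕ} (hg : 0 < g) (m : ℤ) :
    ∑ k ∈ Finset.range g, e ((m : ℝ) / g * k) = if (g : ℤ) ∣ m then (g : ℂ) else 0 := by
  have hg0 : (g : ℝ) ≠ 0 := by exact_mod_cast hg.ne'
  simp only [e_mul_natCast]
  split_ifs with h
  · obtain ⟨c, rfl⟩ := h
    have : ((g * c : ℤ) : ℝ) / g = (c : ℤ) := by push_cast; field_simp
    rw [this, e_intCast]
    simp
  · have hz : e ((m : ℝ) / g) ≠ 1 := by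
      intro h1
      have h2 := two_mul_nearestIntDist_le ((m : ℝ) / g)
      rw [h1, sub_self, norm_zero] at h2
      have h3 : nearestIntDist ((m : ℝ) / g) = 0 :=
        le_antisymm (by linarith) (nearestIntDist_nonneg _)
      rw [nearestIntDist, abs_eq_zero, sub_eq_zero, div_eq_iff hg0] at h3
      refine h ⟨round ((m : ℝ) / g), ?_⟩
      have : (m : ℝ) = ((g * round ((m : ℝ) / g) : ℤ) : ℝ) := by
        push_cast; rw [mul_comm]; exact h3
      exact_mod_cast this
    have h1 := geom_sum_mul (e ((m : ℝ) / g)) g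
    rw [← e_mul_natCast, div_mul_cancel₀ _ hg0, e_intCast, sub_self] at h1
    exact (mul_eq_zero.mp h1).resolve_right (sub_ne_zero.mpr hz)

/-- Detecting a residue class with additive characters. -/
lemma norm_sum_residue_class_le {g : ℕ} (hg : 0 < g) {R : ℝ} (i : ℤ) (γ : ℝ) (s : Finset ℕ)
    (c : ℕ → ℂ)
    (hR : ∀ k ∈ Finset.range g, ‖∑ n ∈ s, c n * e ((γ + k / g) * n)‖ ≤ R) :
    ‖∑ n ∈ s, if (n : ℤ) ≡ i [ZMOD (g : ℤ)] then c n * e (γ * n) else 0‖ ≤ R := by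
  have hg0 : (0 : ℝ) < g := by exact_mod_cast hg
  have hgC : (g : ℂ) ≠ 0 := by exact_mod_cast hg.ne'
  have h1 : (g : ℂ) * ∑ n ∈ s, (if (n : ℤ) ≡ i [ZMOD (g : ℤ)] then c n * e (γ * n) else 0) =
      ∑ k ∈ Finset.range g, e (-(i * k / g)) * ∑ n ∈ s, c n * e ((γ + k / g) * n) := by
    simp_rw [Finset.mul_sum]
    rw [Finset.sum_comm]
    refine Finset.sum_congr rfl fun n _ => ?_
    have h2 : ∀ k ∈ Finset.range g, e (-(i * k / g)) * (c n * e ((γ + k / g) * n)) =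
        c n * e (γ * n) * e (((n - i : ℤ) : ℝ) / g * k) := by
      intro k _
      have : e (-(i * k / g)) * e ((γ + k / g) * n) =
          e (γ * n) * e (((n - i : ℤ) : ℝ) / g * k) := by
        rw [← e_add, ← e_add]; congr 1; push_cast; ring
      linear_combination c n * this
    rw [Finset.sum_congr rfl h2, ← Finset.mul_sum, sum_range_e_eq_ite hg]
    have h3 : (n : ℤ) ≡ i [ZMOD (g : ℤ)] ↔ (g : ℤ) ∣ n - i := by
      rw [Int.modEq_comm, Int.modEq_iff_dvd]
    by_cases h : (g : ℤ) ∣ n - i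
    · rw [if_pos h, if_pos (h3.mpr h), mul_comm]
    · rw [if_neg h, if_neg (mt h3.mp h)]; simp
  have h4 : (g : ℝ) * ‖∑ n ∈ s, (if (n : ℤ) ≡ i [ZMOD (g : ℤ)] then c n * e (γ * n) else 0)‖ ≤
      g * R := by
    calc _ = ‖(g : ℂ) * ∑ n ∈ s, (if (n : ℤ) ≡ i [ZMOD (g : ℤ)] then c n * e (γ * n) else 0)‖ := by
          rw [norm_mul, Complex.norm_natCast]
      _ ≤ ∑ k ∈ Finset.range g, R := by
          rw [h1]
          refine (norm_sum_le _ _).trans (Finset.sum_le_sum fun k hk => ?_)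
          rw [norm_mul, norm_e, one_mul]
          exact hR k hk
      _ = g * R := by simp
  exact le_of_mul_le_mul_left h4 hg0

lemma one_div_two_mul_le_abs {α : ℝ} {a : ℤ} {q : ℕ} (hq : 1 ≤ q) (hcop : Int.gcd a q = 1)
    (happ : |α - (a : ℝ) / q| ≤ 1 / (q : ℝ) ^ 2) {n : ℕ} (hn : 0 < n) (hnq : 2 * n ≤ q) (m : ℤ) :
    1 / (2 * q : ℝ) ≤ |α * n + m| := by
  have hq0 : (0 : ℝ) < q := by exact_mod_cast hq
  have hne : a * n + m * q ≠ 0 := by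
    intro h0
    have h1 : (q : ℤ) ∣ a * n := ⟨-m, by linear_combination h0⟩
    have h2 : IsCoprime (q : ℤ) a := (Int.isCoprime_iff_gcd_eq_one.mpr hcop).symm
    have h3 : (q : ℤ) ∣ n := h2.dvd_of_dvd_mul_left h1
    have h4 := Nat.le_of_dvd hn (Int.natCast_dvd_natCast.mp h3)
    omega
  have h1 : (1 : ℝ) ≤ |(a : ℝ) * n + m * q| := by
    exact_mod_cast Int.one_le_abs hne
  have h2 : 1 / (q : ℝ) ≤ |(a : ℝ) / q * n + m| := by
    rw [show (a : ℝ) / q * n + m = (a * n + m * q) / q by field_simp, abs_div, abs_of_pos hq0]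
    gcongr
  have h3 : |(α - (a : ℝ) / q) * n| ≤ 1 / (2 * q) := by
    rw [abs_mul, Nat.abs_cast]
    have hnq' : (2 : ℝ) * n ≤ q := by exact_mod_cast hnq
    calc |α - (a : ℝ) / q| * n ≤ 1 / (q : ℝ) ^ 2 * (q / 2) := by gcongr; linarith
      _ = 1 / (2 * q) := by field_simp
  have h4 : |(a : ℝ) / q * n + m| ≤ |α * n + m| + |(α - (a : ℝ) / q) * n| := by
    have := abs_sub (α * n + m) ((α - (a : ℝ) / q) * n)
    rwa [show α * n + m - (α - (a : ℝ) / q) * n = (a : ℝ) / q * n + m by ring] at this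
  have h5 : 1 / (q : ℝ) = 1 / (2 * q) + 1 / (2 * q) := by field_simp; norm_num
  linarith

lemma separation_of_rational_approx {α : ℝ} {a : ℤ} {q A g : ℕ} (hA : 0 < A) (hg : 0 < g)
    (hq : 1 ≤ q) (hcop : Int.gcd a q = 1) (happ : |α - (a : ℝ) / q| ≤ 1 / (q : ℝ) ^ 2)
    (k : ℕ) {h : ℕ} (h1 : 1 ≤ h) (hq2 : 2 * g * A * h ≤ q) :
    1 / ((2 * g * q : ℕ) : ℝ) ≤ nearestIntDist ((α * A + k / g) * h) := by
  have hg0 : (0 : ℝ) < g := by exact_mod_cast hg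
  have key := one_div_two_mul_le_abs hq hcop happ (n := g * A * h) (by positivity)
    (by linarith) (k * h - g * round ((α * A + k / g) * h))
  have heq : α * ((g * A * h : ℕ) : ℝ) + ((k * h - g * round ((α * A + k / g) * h) : ℤ) : ℝ) =
      g * ((α * A + k / g) * h - round ((α * A + k / g) * h)) := by
    push_cast; field_simp; ring
  rw [heq, abs_mul, abs_of_pos hg0] at key
  rw [nearestIntDist, show ((2 * g * q : ℕ) : ℝ) = 2 * q * g by push_cast; ring, ← div_div,
    div_le_iff₀ hg0]
  linarith

lemma sq_div_add_sq_div_add_mul_le_sq {x K : ℝ} {q Q : ℕ} (hx : 0 < x) (hK : 1 ≤ K) (hq : 1 ≤ q)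
    (hQ : 1 ≤ Q) (hQq : Q ≤ q) (hqQ : (q : ℝ) ≤ 2 * K * Q) :
    x ^ 2 / Q + x ^ 2 / x ^ ((2 : ℝ) / 5) + x * Q ≤
      (2 * K * (x ^ ((4 : ℝ) / 5) + x * (q : ℝ) ^ (-(1 : ℝ) / 2)
        + x ^ ((1 : ℝ) / 2) * (q : ℝ) ^ ((1 : ℝ) / 2))) ^ 2 := by
  have hq0 : (0 : ℝ) < q := by exact_mod_cast hq
  have hQ0 : (0 : ℝ) < Q := by exact_mod_cast hQ
  have hQq' : (Q : ℝ) ≤ q := by exact_mod_cast hQq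
  obtain ⟨w₁, hw₁⟩ : ∃ w, w = x ^ ((4 : ℝ) / 5) := ⟨_, rfl⟩
  obtain ⟨w₂, hw₂⟩ : ∃ w, w = x * (q : ℝ) ^ (-(1 : ℝ) / 2) := ⟨_, rfl⟩
  obtain ⟨w₃, hw₃⟩ : ∃ w, w = x ^ ((1 : ℝ) / 2) * (q : ℝ) ^ ((1 : ℝ) / 2) := ⟨_, rfl⟩
  have p₁ : 0 ≤ w₁ := by rw [hw₁]; positivity
  have p₂ : 0 ≤ w₂ := by rw [hw₂]; positivity
  have p₃ : 0 ≤ w₃ := by rw [hw₃]; positivity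
  have s₁ : w₁ ^ 2 = x ^ 2 / x ^ ((2 : ℝ) / 5) := by
    rw [eq_div_iff (by positivity), hw₁, ← Real.rpow_natCast, ← Real.rpow_mul hx.le,
      ← Real.rpow_add hx, ← Real.rpow_natCast x]
    norm_num
  have s₂ : w₂ ^ 2 = x ^ 2 / q := by
    rw [hw₂, mul_pow, ← Real.rpow_natCast ((q : ℝ) ^ _), ← Real.rpow_mul hq0.le,
      show -(1 : ℝ) / 2 * (2 : ℕ) = -1 by norm_num, Real.rpow_neg_one, div_eq_mul_inv]
  have s₃ : w₃ ^ 2 = x * q := by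
    rw [hw₃, ← Real.sqrt_eq_rpow, ← Real.sqrt_eq_rpow, mul_pow, Real.sq_sqrt hx.le,
      Real.sq_sqrt hq0.le]
  rw [← hw₁, ← hw₂, ← hw₃, ← s₁, mul_pow]
  have e₁ : w₁ ^ 2 ≤ 2 * K * w₁ ^ 2 := le_mul_of_one_le_left (sq_nonneg _) (by linarith)
  have e₂ : x ^ 2 / Q ≤ 2 * K * w₂ ^ 2 := by
    rw [s₂, ← mul_div_assoc, div_le_div_iff₀ hQ0 hq0]
    calc x ^ 2 * q ≤ x ^ 2 * (2 * K * Q) := by gcongr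
      _ = _ := by ring
  have e₃ : x * Q ≤ 2 * K * w₃ ^ 2 := by
    refine le_trans ?_ (le_mul_of_one_le_left (sq_nonneg _) (by linarith))
    rw [s₃]; gcongr
  have e₄ : w₁ ^ 2 + w₂ ^ 2 + w₃ ^ 2 ≤ (w₁ + w₂ + w₃) ^ 2 := by
    linarith [mul_nonneg p₁ p₂, mul_nonneg p₁ p₃, mul_nonneg p₂ p₃,
      (by ring : (w₁ + w₂ + w₃) ^ 2 =
        w₁ ^ 2 + w₂ ^ 2 + w₃ ^ 2 + 2 * (w₁ * w₂) + 2 * (w₁ * w₃) + 2 * (w₂ * w₃))]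
  calc x ^ 2 / Q + w₁ ^ 2 + x * Q ≤ 2 * K * (w₁ ^ 2 + w₂ ^ 2 + w₃ ^ 2) := by linarith
    _ ≤ (2 * K) ^ 2 * (w₁ + w₂ + w₃) ^ 2 :=
        mul_le_mul (le_self_pow₀ (by linarith) two_ne_zero) e₄ (by positivity) (by positivity)

lemma natCast_mul_one_add_log_le {x D : ℝ} {Q N : ℕ} (hD : 1 ≤ D) (hQ : 1 ≤ Q) (hN : 1 ≤ N)
    (hQx : (Q : ℝ) ≤ x) (hND : (N : ℝ) ≤ D * Q) :
    (N : ℝ) * (1 + Real.log N) ≤ D ^ 2 * Q * (1 + Real.log x) := by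
  have hQ0 : (1 : ℝ) ≤ Q := by exact_mod_cast hQ
  have hN0 : (1 : ℝ) ≤ N := by exact_mod_cast hN
  have hL : 0 ≤ Real.log x := Real.log_nonneg (hQ0.trans hQx)
  have h1 : Real.log N ≤ Real.log D + Real.log Q := by
    rw [← Real.log_mul (by linarith) (by linarith)]
    exact Real.log_le_log (by linarith) hND
  have h2 : Real.log D ≤ D - 1 := Real.log_le_sub_one_of_pos (by linarith)
  have h3 : Real.log Q ≤ Real.log x := Real.log_le_log (by linarith) hQx
  have h4 : 1 + Real.log N ≤ D * (1 + Real.log x) := by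
    linarith [le_mul_of_one_le_left hL hD]
  have h5 : 0 ≤ Real.log N := Real.log_natCast_nonneg N
  calc (N : ℝ) * (1 + Real.log N) ≤ (D * Q) * (D * (1 + Real.log x)) := by gcongr
    _ = _ := by ring

lemma norm_sum_prime_e_le {β x D K : ℝ} {q Q N : ℕ} (hx : 2 ≤ x) (hK : 1 ≤ K) (hD : 1 ≤ D)
    (hq : 1 ≤ q) (hQ : 1 ≤ Q) (hN : 1 ≤ N) (hQq : Q ≤ q) (hqQ : (q : ℝ) ≤ 2 * K * Q)
    (hqx : (q : ℝ) ≤ x) (hND : (N : ℝ) ≤ D * Q)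
    (hsp : ∀ h : ℕ, 1 ≤ h → h < Q → 1 / (N : ℝ) ≤ nearestIntDist (β * h)) :
    ‖∑ n ∈ Finset.Ioc 0 ⌊x⌋₊, (if n.Prime then (Real.log n : ℂ) * e (β * n) else 0)‖ ≤
      (1566 * D ^ 2 * K + 8) * (x ^ ((4 : ℝ) / 5) + x * (q : ℝ) ^ (-(1 : ℝ) / 2)
                + x ^ ((1 : ℝ) / 2) * (q : ℝ) ^ ((1 : ℝ) / 2)) * Real.log x ^ 3 := by
  have hx0 : 0 < x := by linarith
  have hq0 : (1 : ℝ) ≤ q := by exact_mod_cast hq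
  have hQ0 : (1 : ℝ) ≤ Q := by exact_mod_cast hQ
  have hN0 : (1 : ℝ) ≤ N := by exact_mod_cast hN
  have hQq' : (Q : ℝ) ≤ q := by exact_mod_cast hQq
  have hlog2 : Real.log 2 ≤ Real.log x := Real.log_le_log (by norm_num) hx
  have hL : 1 / 2 ≤ Real.log x := by linarith [Real.log_two_gt_d9]
  set L := Real.log x with hLdef
  set w₁ := x ^ ((4 : ℝ) / 5) with hw₁
  set w₂ := x * (q : ℝ) ^ (-(1 : ℝ) / 2) with hw₂
  set w₃ := x ^ ((1 : ℝ) / 2) * (q : ℝ) ^ ((1 : ℝ) / 2) with hw₃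
  have p₁ : 0 ≤ w₁ := by positivity
  have p₂ : 0 ≤ w₂ := by positivity
  have p₃ : 0 ≤ w₃ := by positivity
  have hy0 : 0 < x ^ ((2 : ℝ) / 5) := by positivity
  have hyx : (x ^ ((2 : ℝ) / 5)) ^ 5 = x ^ 2 := by
    rw [← Real.rpow_natCast, ← Real.rpow_mul hx0.le, ← Real.rpow_natCast]; norm_num
  have hWx : x ^ 2 / Q + x ^ 2 / x ^ ((2 : ℝ) / 5) + x * Q ≤ (2 * K * (w₁ + w₂ + w₃)) ^ 2 :=
    sq_div_add_sq_div_add_mul_le_sq hx0 hK hq hQ hQq hqQ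
  have hNQ : (N : ℝ) * (1 + Real.log N) ≤ D ^ 2 * Q * (1 + L) :=
    natCast_mul_one_add_log_le hD hQ hN (hQq'.trans hqx) hND
  have main := norm_sum_vonMangoldt_e_le (β := β) (by linarith) hy0 hyx rfl hD
    (by positivity : 0 ≤ 2 * K * (w₁ + w₂ + w₃)) hQ hN (hQq'.trans hqx) hNQ hWx hsp
  have hdiff := norm_sum_prime_sub_vonMangoldt_le (x := x) (by linarith) β
  have hsqrt : √x ≤ w₁ + w₂ + w₃ := by
    have : √x ≤ w₁ := by
      rw [Real.sqrt_eq_rpow, hw₁]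
      exact Real.rpow_le_rpow_of_exponent_le (by linarith) (by norm_num)
    linarith
  have hL1 : L ≤ 4 * L ^ 3 := by
    calc L = 4 * (L * (1 / 2) ^ 2) := by ring
      _ ≤ 4 * (L * L ^ 2) := by gcongr
      _ = 4 * L ^ 3 := by ring
  have hL3 : (1 + L) ^ 3 ≤ 27 * L ^ 3 := by
    calc (1 + L) ^ 3 ≤ (3 * L) ^ 3 := by gcongr; linarith
      _ = _ := by ring
  set w := w₁ + w₂ + w₃ with hw
  have hw0 : 0 ≤ w := by positivity
  calc _ ≤ 29 * D ^ 2 * (1 + L) ^ 3 * (2 * K * w) + 2 * √x * L := by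
        have := norm_add_le
          (∑ n ∈ Finset.Ioc 0 ⌊x⌋₊, (if n.Prime then (Real.log n : ℂ) * e (β * n) else 0)
            - ∑ n ∈ Finset.Ioc 0 ⌊x⌋₊, (Λ n : ℂ) * e (β * n))
          (∑ n ∈ Finset.Ioc 0 ⌊x⌋₊, (Λ n : ℂ) * e (β * n))
        rw [sub_add_cancel] at this
        linarith
    _ ≤ 29 * D ^ 2 * (27 * L ^ 3) * (2 * K * w) + 2 * w * (4 * L ^ 3) := by gcongr
    _ = _ := by ring

lemma norm_sum_prime_residue_le_const_mul {A g : ℕ} (i : ℤ) (α : ℝ) {x : ℝ} (hx : 0 ≤ x) :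
    ‖∑ p ∈ (Finset.Icc 1 ⌊x⌋₊).filter
        (fun p : ℕ => p.Prime ∧ (p : ℤ) ≡ i [ZMOD (g : ℤ)]),
        (Real.log p : ℂ) * e (α * (A * p))‖ ≤ 2 * x := by
  have h4 : Real.log 4 ≤ 2 := by
    rw [show (4 : ℝ) = 2 ^ 2 by norm_num, Real.log_pow]; push_cast
    linarith [Real.log_two_lt_d9]
  have hθ : Chebyshev.theta x ≤ 2 * x := (Chebyshev.theta_le_log4_mul_x hx).trans (by gcongr)
  refine le_trans ?_ hθ
  rw [Chebyshev.theta]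
  calc _ ≤ ∑ p ∈ (Finset.Icc 1 ⌊x⌋₊).filter
        (fun p : ℕ => p.Prime ∧ (p : ℤ) ≡ i [ZMOD (g : ℤ)]), Real.log p := by
        refine (norm_sum_le _ _).trans (Finset.sum_le_sum fun p _ => ?_)
        rw [norm_mul, norm_e, mul_one, Complex.norm_real,
          Real.norm_of_nonneg (Real.log_natCast_nonneg p)]
    _ ≤ _ := by
        apply Finset.sum_le_sum_of_subset_of_nonneg
        · intro p hp
          simp only [Finset.mem_filter, Finset.mem_Icc, Finset.mem_Ioc] at hp ⊢
          exact ⟨⟨by omega, hp.1.2⟩, hp.2.1⟩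
        · intro p _ _; exact Real.log_natCast_nonneg p

/-- Minor-arc bound for the exponential sum over primes in a fixed
residue class `i (mod g)`: if `|α - a/q| ≤ 1/q²` with `gcd(a,q)=1`, then
`|∑_{p ≤ x, p ≡ i (g)} (log p) e(αAp)| ≤ C (x^{4/5} + x q^{-1/2} + x^{1/2} q^{1/2}) (log x)³`. -/
theorem prime_exponential_sum_residue_class_bound
    (A g : ℕ) (hA : 0 < A) (hg : 0 < g) :
    ∃ C : ℝ, ∀ (i : ℤ), Int.gcd i g = 1 →
      ∀ (α : ℝ) (a : ℤ) (q : ℕ), 1 ≤ q → Int.gcd a q = 1 →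
        |α - (a : ℝ) / q| ≤ 1 / (q : ℝ) ^ 2 →
        ∀ x : ℝ, 2 ≤ x →
          ‖∑ p ∈ (Finset.Icc 1 ⌊x⌋₊).filter
              (fun p : ℕ => p.Prime ∧ (p : ℤ) ≡ i [ZMOD (g : ℤ)]),
              (Real.log p : ℂ) * e (α * (A * p))‖
            ≤ C * (x ^ ((4 : ℝ) / 5) + x * (q : ℝ) ^ (-(1 : ℝ) / 2)
                + x ^ ((1 : ℝ) / 2) * (q : ℝ) ^ ((1 : ℝ) / 2)) * Real.log x ^ 3 := by
  obtain ⟨K, hK⟩ : ∃ K : ℕ, K = 2 * g * A := ⟨_, rfl⟩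
  have hK1 : 1 ≤ K := by rw [hK]; exact Nat.one_le_iff_ne_zero.mpr (by positivity)
  have hK0 : (1 : ℝ) ≤ K := by exact_mod_cast hK1
  have hg1 : (1 : ℝ) ≤ g := by exact_mod_cast hg
  have hD : (1 : ℝ) ≤ 4 * g * K := by nlinarith
  refine ⟨1566 * (4 * g * K : ℝ) ^ 2 * K + 8 + 16 * K, ?_⟩
  intro i _ α a q hq hcop happ x hx
  have hx0 : 0 < x := by linarith
  have hq0 : (1 : ℝ) ≤ q := by exact_mod_cast hq
  have hL : 1 / 2 ≤ Real.log x := by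
    linarith [Real.log_two_gt_d9, Real.log_le_log (by norm_num : (0 : ℝ) < 2) hx]
  set w := x ^ ((4 : ℝ) / 5) + x * (q : ℝ) ^ (-(1 : ℝ) / 2)
    + x ^ ((1 : ℝ) / 2) * (q : ℝ) ^ ((1 : ℝ) / 2) with hw
  have p₁ : 0 ≤ x ^ ((4 : ℝ) / 5) := by positivity
  have p₂ : 0 ≤ x * (q : ℝ) ^ (-(1 : ℝ) / 2) := by positivity
  have p₃ : 0 ≤ x ^ ((1 : ℝ) / 2) * (q : ℝ) ^ ((1 : ℝ) / 2) := by positivity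
  have hw0 : 0 ≤ w := by positivity
  have hL3 : (1 / 2 : ℝ) ^ 3 ≤ Real.log x ^ 3 := by gcongr
  have hL30 : 0 ≤ Real.log x ^ 3 := by positivity
  have htriv : x ≤ K * w → 2 * x ≤
      (1566 * (4 * g * K : ℝ) ^ 2 * K + 8 + 16 * K) * w * Real.log x ^ 3 := by
    intro h
    calc 2 * x ≤ 16 * (K * w) * (1 / 2 : ℝ) ^ 3 := by norm_num; linarith
      _ ≤ 16 * (K * w) * Real.log x ^ 3 := by gcongr
      _ ≤ _ := by
        have : 0 ≤ (1566 * (4 * g * K : ℝ) ^ 2 * K + 8) * w * Real.log x ^ 3 := by positivity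
        linarith
  by_cases hqx : (q : ℝ) ≤ x
  swap
  · refine (norm_sum_prime_residue_le_const_mul i α hx0.le).trans (htriv ?_)
    have h1 : x ≤ x ^ ((1 : ℝ) / 2) * (q : ℝ) ^ ((1 : ℝ) / 2) := by
      calc x = x ^ ((1 : ℝ) / 2) * x ^ ((1 : ℝ) / 2) := by
            rw [← Real.rpow_add hx0]; norm_num
        _ ≤ _ := by gcongr; linarith
    nlinarith
  by_cases hqK : K ≤ q
  swap
  · refine (norm_sum_prime_residue_le_const_mul i α hx0.le).trans (htriv ?_)
    have hqK' : (q : ℝ) ≤ K := by exact_mod_cast (by omega : q ≤ K)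
    have h1 : (K : ℝ)⁻¹ ≤ (q : ℝ) ^ (-(1 : ℝ) / 2) := by
      calc (K : ℝ)⁻¹ ≤ (q : ℝ)⁻¹ := by gcongr
        _ = (q : ℝ) ^ (-1 : ℝ) := (Real.rpow_neg_one _).symm
        _ ≤ _ := Real.rpow_le_rpow_of_exponent_le hq0 (by norm_num)
    have h2 : x ≤ K * (x * (q : ℝ) ^ (-(1 : ℝ) / 2)) := by
      calc x = K * (x * (K : ℝ)⁻¹) := by field_simp
        _ ≤ _ := by gcongr
    nlinarith
  set Q := q / K with hQ
  have hQ1 : 1 ≤ Q := Nat.div_pos hqK hK1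
  have hQ0 : (1 : ℝ) ≤ Q := by exact_mod_cast hQ1
  have hqQ : (q : ℝ) ≤ 2 * K * Q := by
    have h1 : q < Q * K + K := Nat.lt_div_mul_add hK1
    have h2 : (q : ℝ) ≤ Q * K + K := by exact_mod_cast h1.le
    nlinarith
  have hsum : ∑ p ∈ (Finset.Icc 1 ⌊x⌋₊).filter
      (fun p : ℕ => p.Prime ∧ (p : ℤ) ≡ i [ZMOD (g : ℤ)]), (Real.log p : ℂ) * e (α * (A * p)) =
      ∑ n ∈ Finset.Ioc 0 ⌊x⌋₊, if (n : ℤ) ≡ i [ZMOD (g : ℤ)] then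
        (if n.Prime then (Real.log n : ℂ) else 0) * e (α * A * n) else 0 := by
    rw [Finset.sum_filter]
    refine Finset.sum_congr (by ext; simp only [Finset.mem_Icc, Finset.mem_Ioc]; omega)
      fun n _ => ?_
    by_cases h1 : n.Prime <;> by_cases h2 : (n : ℤ) ≡ i [ZMOD (g : ℤ)] <;> simp [h1, h2, mul_assoc]
  rw [hsum]
  refine norm_sum_residue_class_le hg i (α * A) _ _ fun k _ => ?_
  have hmain := norm_sum_prime_e_le (β := α * A + k / g) (D := 4 * g * K) (K := K) (q := q)
    (Q := Q) (N := 2 * g * q) hx hK0 hD hq hQ1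
    (Nat.one_le_iff_ne_zero.mpr (by positivity)) (Nat.div_le_self _ _) hqQ hqx
    (by push_cast; nlinarith)
    (fun h h1 hh => separation_of_rational_approx hA hg hq hcop happ k h1 (by
      rw [← hK]
      exact (Nat.mul_le_mul_left K hh.le).trans (Nat.mul_div_le q K)))
  have hconv : ∑ n ∈ Finset.Ioc 0 ⌊x⌋₊, (if n.Prime then (Real.log n : ℂ) else 0) *
      e ((α * A + k / g) * n) = ∑ n ∈ Finset.Ioc 0 ⌊x⌋₊,
        (if n.Prime then (Real.log n : ℂ) * e ((α * A + k / g) * n) else 0) := by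
    refine Finset.sum_congr rfl fun n _ => ?_
    by_cases h : n.Prime <;> simp [h]
  rw [hconv]
  rw [← hw] at hmain
  refine hmain.trans ?_
  have : 0 ≤ 16 * (K : ℝ) * w * Real.log x ^ 3 := by positivity
  linarith
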